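/- Let p, q ∈ (2, ∞) with q < p. (i) For every c₀ ∈ (0, ∞) there exist constants c, C ∈ (0, ∞) depending only on p, q, c₀ such that for all m, n ∈ ℕ with m ≥ c₀ · n^{(p−q)/(q(p−2))}, one has c · c_p(ℓ_q^n) ≤ c_p([m]_q^n) ≤ C · c_p(ℓ_q^n). (ii) For every sequence (m_n)_{n∈ℕ} of positive integers with lim_{n→∞} m_n / n^{(p−q)/(q(p−2))} = 0, one has lim_{n→∞} c_p([m_n]_q^n) / c_p(ℓ_q^n) = 0. -/

import Mathlib

open Finset

/-- The Lebesgue space `L_p(ℝ)` (with `p ∈ [1,∞)` given as a real number). -/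
noncomputable abbrev LpSpace (p : ℝ) :=
  MeasureTheory.Lp ℝ (ENNReal.ofReal p) (MeasureTheory.volume : MeasureTheory.Measure ℝ)

/-- The `ℓ_q^n` metric on `ℝ^n`: `d(x,y) = (Σ_i |x_i - y_i|^q)^{1/q}`. -/
noncomputable def lqDist {n : ℕ} (q : ℝ) (x y : Fin n → ℝ) : ℝ :=
  (∑ i, |x i - y i| ^ q) ^ (1 / q)

/-- The `ℓ_q^n` metric on the grid `{1,…,m}^n` (encoded as `Fin n → Fin m`). -/
noncomputable def gridDist (q : ℝ) {n m : ℕ} (x y : Fin n → Fin m) : ℝ :=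
  lqDist q (fun i => ((x i : ℕ) : ℝ)) (fun i => ((y i : ℕ) : ℝ))

/-- The `L_p` distortion `c_p(X, d)` of a distance function `d` on `X`: the infimum of those
`D ∈ [1,∞)` for which there is `f : X → L_p` with
`d(x,y) ≤ ‖f(x) - f(y)‖_{L_p} ≤ D d(x,y)` for all `x, y ∈ X`. -/
noncomputable def LpDistortion (p : ℝ) {X : Type*} (d : X → X → ℝ) : ℝ :=
  sInf {D : ℝ | 1 ≤ D ∧ ∃ f : X → LpSpace p,
    ∀ x y : X, d x y ≤ ‖f x - f y‖ ∧ ‖f x - f y‖ ≤ D * d x y}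

theorem norm_card_inv_smul_sum_rpow_le {α V : Type*} [Fintype α] [Nonempty α]
    [SeminormedAddCommGroup V] [NormedSpace ℝ V] (v : α → V) {s : ℝ} (hs : 1 ≤ s) :
    ‖(Fintype.card α : ℝ)⁻¹ • ∑ a, v a‖ ^ s ≤ (Fintype.card α : ℝ)⁻¹ * ∑ a, ‖v a‖ ^ s := by
  have hN : (0 : ℝ) < Fintype.card α := by exact_mod_cast Fintype.card_pos
  have h1 := Real.rpow_arith_mean_le_arith_mean_rpow Finset.univ
    (fun _ : α => (Fintype.card α : ℝ)⁻¹) (fun a => ‖v a‖) (fun _ _ => by positivity)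
    (by simp [hN.ne']) (fun _ _ => norm_nonneg _) hs
  rw [← Finset.mul_sum, ← Finset.mul_sum] at h1
  refine le_trans (Real.rpow_le_rpow (norm_nonneg _) ?_ (by linarith)) h1
  rw [norm_smul, Real.norm_of_nonneg (by positivity)]
  gcongr
  exact norm_sum_le _ _

theorem abs_card_inv_mul_sum_rpow_le {α : Type*} [Fintype α] [Nonempty α]
    (v : α → ℝ) {s : ℝ} (hs : 1 ≤ s) :
    |(Fintype.card α : ℝ)⁻¹ * ∑ a, v a| ^ s ≤ (Fintype.card α : ℝ)⁻¹ * ∑ a, |v a| ^ s :=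
  norm_card_inv_smul_sum_rpow_le v hs

/-- Tangent line inequality for `u ↦ u ^ s`. -/
theorem rpow_sub_rpow_le {a b s : ℝ} (ha : 0 < a) (hb : 0 ≤ b) (hs : 1 ≤ s) :
    a ^ s - b ^ s ≤ s * a ^ (s - 1) * (a - b) := by
  have h := one_add_mul_self_le_rpow_one_add (s := b / a - 1)
    (by linarith [div_nonneg hb ha.le]) hs
  rw [add_sub_cancel, Real.div_rpow hb ha.le, le_div_iff₀ (by positivity)] at h
  have e : a ^ s = a ^ (s - 1) * a := by rw [← Real.rpow_add_one ha.ne']; simp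
  have : (1 + s * (b / a - 1)) * a ^ s = a ^ s + s * a ^ (s - 1) * (b - a) := by
    rw [e]; field_simp
  linarith

theorem two_point_rpow_le_of_nonneg {p M c : ℝ} (hp : 2 ≤ p) (hM : 0 ≤ M) (hc : 0 ≤ c) :
    (M + c) ^ p + |M - c| ^ p ≤
      2 * (M ^ p + p * (p - 1) * 2 ^ p * (M ^ (p - 2) * c ^ 2) + 2 ^ p * c ^ p) := by
  have hp0 : 0 < p := by linarith
  have n1 : 0 ≤ p * (p - 1) * 2 ^ p * (M ^ (p - 2) * c ^ 2) := by
    have : 0 ≤ p - 1 := by linarith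
    positivity
  rcases le_or_gt M c with h | h
  · have h1 : (M + c) ^ p ≤ 2 ^ p * c ^ p := by
      rw [← Real.mul_rpow (by norm_num) hc]
      exact Real.rpow_le_rpow (by linarith) (by linarith) hp0.le
    have h2 : |M - c| ^ p ≤ 2 ^ p * c ^ p := by
      rw [← Real.mul_rpow (by norm_num) hc]
      exact Real.rpow_le_rpow (abs_nonneg _) (by rw [abs_le]; constructor <;> linarith) hp0.le
    have : 0 ≤ M ^ p := by positivity
    linarith
  · have hMc : 0 < M - c := by linarith
    have hM' : 0 < M := by linarith
    rw [abs_of_pos hMc]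
    have t1 := rpow_sub_rpow_le (a := M + c) (b := M) (s := p) (by linarith) hM (by linarith)
    have t2 := rpow_sub_rpow_le (a := M - c) (b := M) (s := p) hMc hM (by linarith)
    have t3 := rpow_sub_rpow_le (a := M + c) (b := M - c) (s := p - 1) (by linarith) hMc.le
      (by linarith)
    have e : p - 1 - 1 = p - 2 := by ring
    rw [e] at t3
    have t4 : (M + c) ^ (p - 2) ≤ 2 ^ p * M ^ (p - 2) := by
      calc (M + c) ^ (p - 2) ≤ (2 * M) ^ (p - 2) :=
            Real.rpow_le_rpow (by linarith) (by linarith) (by linarith)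
        _ = 2 ^ (p - 2) * M ^ (p - 2) := Real.mul_rpow (by norm_num) hM
        _ ≤ _ := by
            gcongr
            · norm_num
            · linarith
    have t5 : (M + c) ^ p + (M - c) ^ p ≤ 2 * M ^ p +
        p * c * ((M + c) ^ (p - 1) - (M - c) ^ (p - 1)) := by nlinarith
    have t6 : p * c * ((M + c) ^ (p - 1) - (M - c) ^ (p - 1)) ≤
        p * c * ((p - 1) * (2 ^ p * M ^ (p - 2)) * (2 * c)) := by
      refine mul_le_mul_of_nonneg_left (t3.trans ?_) (by positivity)
      have : M + c - (M - c) = 2 * c := by ring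
      rw [this]
      have : 0 ≤ p - 1 := by linarith
      gcongr
    have : 0 ≤ 2 ^ p * c ^ p := by positivity
    nlinarith

theorem two_point_rpow_le {p : ℝ} (hp : 2 ≤ p) (M c : ℝ) :
    |M + c| ^ p + |M - c| ^ p ≤
      2 * (|M| ^ p + p * (p - 1) * 2 ^ p * (|M| ^ (p - 2) * c ^ 2) + 2 ^ p * |c| ^ p) := by
  have h := two_point_rpow_le_of_nonneg hp (abs_nonneg M) (abs_nonneg c)
  rw [sq_abs] at h
  refine le_trans (le_of_eq ?_) h
  rcases le_total 0 M with hM | hM <;> rcases le_total 0 c with hc | hc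
  · rw [abs_of_nonneg hM, abs_of_nonneg hc, abs_of_nonneg (add_nonneg hM hc)]
  · rw [abs_of_nonneg hM, abs_of_nonpos hc, sub_neg_eq_add, ← sub_eq_add_neg,
      abs_of_nonneg (by linarith : 0 ≤ M - c), add_comm]
  · rw [abs_of_nonpos hM, abs_of_nonneg hc, ← abs_neg (M + c), ← abs_neg (M - c), add_comm,
      abs_of_nonneg (by linarith : 0 ≤ -(M - c))]
    ring_nf
  · rw [abs_of_nonpos hM, abs_of_nonpos hc, ← abs_neg (M + c), ← abs_neg (M - c),
      abs_of_nonneg (by linarith : 0 ≤ -(M + c))]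
    ring_nf

theorem rpow_sub_two_mul_le {p M Q : ℝ} (hp : 2 ≤ p) (hM : 0 ≤ M) (hQ : 0 ≤ Q) :
    M ^ (p - 2) * Q ≤ M ^ p + Q ^ (p / 2) := by
  rcases hM.eq_or_lt with rfl | hM'
  · rcases hp.eq_or_lt with rfl | hp'
    · simp
    · rw [Real.zero_rpow (by linarith), zero_mul]
      positivity
  · have e : M ^ p = M ^ (p - 2) * M ^ 2 := by
      rw [← Real.rpow_natCast, ← Real.rpow_add hM']; norm_num
    rcases le_total Q (M ^ 2) with h | h
    · have : M ^ (p - 2) * Q ≤ M ^ p := by rw [e]; gcongr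
      have : 0 ≤ Q ^ (p / 2) := by positivity
      linarith
    · rcases hQ.eq_or_lt with rfl | hQ'
      · rw [mul_zero]; positivity
      have e2 : Q ^ (p / 2) = Q ^ ((p - 2) / 2) * Q := by
        rw [← Real.rpow_add_one hQ'.ne']; congr 1; ring
      have e3 : M ^ (p - 2) = (M ^ 2) ^ ((p - 2) / 2) := by
        rw [← Real.rpow_natCast, ← Real.rpow_mul hM]; congr 1; push_cast; ring
      have : M ^ (p - 2) * Q ≤ Q ^ (p / 2) := by
        rw [e2, e3]; gcongr
      have : 0 ≤ M ^ p := by positivity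
      linarith

section SignCube

variable {ι : Type*} [DecidableEq ι]

/-- Flip the `j`-th sign. -/
def flipSign (j : ι) (x : ι → ℤˣ) : ι → ℤˣ := Function.update x j (-x j)

theorem flipSign_involutive (j : ι) : Function.Involutive (flipSign j) := by
  intro x; simp [flipSign]

theorem flipSign_same (j : ι) (x : ι → ℤˣ) : flipSign j x j = -x j := by simp [flipSign]

theorem flipSign_of_ne {i j : ι} (h : i ≠ j) (x : ι → ℤˣ) : flipSign j x i = x i := by
  simp [flipSign, h]

theorem piecewise_flipSign_left (S : Finset ι) {j : ι} (hj : j ∉ S) (x η : ι → ℤˣ) :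
    S.piecewise (flipSign j x) η = S.piecewise x η := by
  ext i
  by_cases hi : i ∈ S
  · have : i ≠ j := fun h => hj (h ▸ hi)
    simp [hi, flipSign_of_ne this]
  · simp [hi]

theorem piecewise_flipSign_right (S : Finset ι) {j : ι} (hj : j ∉ S) (x η : ι → ℤˣ) :
    S.piecewise x (flipSign j η) = flipSign j (S.piecewise x η) := by
  ext i
  by_cases hij : i = j
  · subst hij; simp [hj, flipSign_same]
  · by_cases hi : i ∈ S <;> simp [hi, flipSign_of_ne hij]

variable [Fintype ι]

/-- The conditional expectation of `f`, on the sign cube, given the coordinates in `S`. -/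
noncomputable def condAvg {V : Type*} [AddCommGroup V] [Module ℝ V] (S : Finset ι)
    (f : (ι → ℤˣ) → V) (x : ι → ℤˣ) : V :=
  (Fintype.card (ι → ℤˣ) : ℝ)⁻¹ • ∑ η, f (S.piecewise x η)

theorem sum_flipSign {V : Type*} [AddCommMonoid V] (j : ι) (g : (ι → ℤˣ) → V) :
    ∑ x, g (flipSign j x) = ∑ x, g x :=
  Equiv.sum_comp (flipSign_involutive j).toPerm g

theorem sum_sum_piecewise {V : Type*} [AddCommMonoid V] (S : Finset ι) (g : (ι → ℤˣ) → V) :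
    ∑ x, ∑ η, g (S.piecewise x η) = Fintype.card (ι → ℤˣ) • ∑ x, g x := by
  have hinv : Function.Involutive (fun z : (ι → ℤˣ) × (ι → ℤˣ) =>
      (S.piecewise z.1 z.2, S.piecewise z.2 z.1)) := by
    rintro ⟨x, y⟩
    ext j <;> by_cases hj : j ∈ S <;> simp [hj]
  rw [← Fintype.sum_prod_type', ← Equiv.sum_comp hinv.toPerm]
  simp only [Function.Involutive.coe_toPerm]
  have : ∀ z : (ι → ℤˣ) × (ι → ℤˣ),
      g (S.piecewise (S.piecewise z.1 z.2) (S.piecewise z.2 z.1)) = g z.1 := by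
    rintro ⟨x, y⟩
    congr 1
    ext j; by_cases hj : j ∈ S <;> simp [hj]
  simp only [this]
  rw [Fintype.sum_prod_type]
  simp [Finset.smul_sum]

theorem sum_avg_piecewise (S : Finset ι) (g : (ι → ℤˣ) → ℝ) :
    ∑ x, (Fintype.card (ι → ℤˣ) : ℝ)⁻¹ * ∑ η, g (S.piecewise x η) = ∑ x, g x := by
  rw [← Finset.mul_sum, sum_sum_piecewise, nsmul_eq_mul, inv_mul_cancel_left₀]
  exact_mod_cast Fintype.card_ne_zero

theorem cast_units_sq (e : ℤˣ) : ((e : ℤ) : ℝ) * ((e : ℤ) : ℝ) = 1 := by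
  rcases Int.units_eq_one_or e with rfl | rfl <;> simp

theorem sum_sign_mul_sign (i j : ι) :
    ∑ η : ι → ℤˣ, ((η i : ℤ) : ℝ) * ((η j : ℤ) : ℝ) =
      if i = j then (Fintype.card (ι → ℤˣ) : ℝ) else 0 := by
  split_ifs with h
  · subst h; simp only [cast_units_sq]; simp
  · have h1 := sum_flipSign i (fun η : ι → ℤˣ => ((η i : ℤ) : ℝ) * ((η j : ℤ) : ℝ))
    simp only [flipSign_same, flipSign_of_ne (Ne.symm h)] at h1
    simp only [Units.val_neg, Int.cast_neg, neg_mul, Finset.sum_neg_distrib] at h1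
    linarith

/-- The first-level Walsh coefficient. -/
noncomputable def signCoeff (g : (ι → ℤˣ) → ℝ) (j : ι) : ℝ :=
  (Fintype.card (ι → ℤˣ) : ℝ)⁻¹ * ∑ η, ((η j : ℤ) : ℝ) * g η

theorem sum_sign_linear_sq (c : ι → ℝ) (T : Finset ι) :
    ∑ η : ι → ℤˣ, (∑ j ∈ T, c j * ((η j : ℤ) : ℝ)) ^ 2 =
      Fintype.card (ι → ℤˣ) * ∑ j ∈ T, c j ^ 2 := by
  have : ∀ η : ι → ℤˣ, (∑ j ∈ T, c j * ((η j : ℤ) : ℝ)) ^ 2 =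
      ∑ i ∈ T, ∑ j ∈ T, c i * c j * (((η i : ℤ) : ℝ) * ((η j : ℤ) : ℝ)) := by
    intro η
    rw [sq, Finset.sum_mul_sum]
    refine Finset.sum_congr rfl fun i _ => Finset.sum_congr rfl fun j _ => by ring
  simp only [this]
  rw [Finset.sum_comm, Finset.mul_sum]
  refine Finset.sum_congr rfl fun i hi => ?_
  rw [Finset.sum_comm]
  simp only [← Finset.mul_sum, sum_sign_mul_sign]
  simp only [mul_ite, mul_zero, Finset.sum_ite_eq, hi, if_true]
  ring

/-- Bessel's inequality for the first-level Walsh coefficients. -/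
theorem sum_signCoeff_sq_le (g : (ι → ℤˣ) → ℝ) (T : Finset ι) :
    ∑ j ∈ T, signCoeff g j ^ 2 ≤ (Fintype.card (ι → ℤˣ) : ℝ)⁻¹ * ∑ η, g η ^ 2 := by
  set N : ℝ := (Fintype.card (ι → ℤˣ) : ℝ) with hN
  have hN0 : 0 < N := by rw [hN]; exact_mod_cast Fintype.card_pos
  have h0 : 0 ≤ ∑ η, (g η - ∑ j ∈ T, signCoeff g j * ((η j : ℤ) : ℝ)) ^ 2 :=
    Finset.sum_nonneg fun _ _ => sq_nonneg _
  have h1 : ∑ η, g η * ∑ j ∈ T, signCoeff g j * ((η j : ℤ) : ℝ) =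
      N * ∑ j ∈ T, signCoeff g j ^ 2 := by
    simp only [Finset.mul_sum]
    rw [Finset.sum_comm]
    refine Finset.sum_congr rfl fun j _ => ?_
    have : ∑ η : ι → ℤˣ, ((η j : ℤ) : ℝ) * g η = N * signCoeff g j := by
      rw [signCoeff, mul_inv_cancel_left₀ hN0.ne']
    rw [sq, ← mul_assoc, ← this, Finset.sum_mul]
    refine Finset.sum_congr rfl fun η _ => by ring
  have h2 := sum_sign_linear_sq (signCoeff g) T
  simp only [sub_sq, Finset.sum_add_distrib, Finset.sum_sub_distrib] at h0
  have h3 : ∑ η, 2 * g η * ∑ j ∈ T, signCoeff g j * ((η j : ℤ) : ℝ) =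
      2 * (N * ∑ j ∈ T, signCoeff g j ^ 2) := by
    rw [← h1, Finset.mul_sum]
    refine Finset.sum_congr rfl fun η _ => by ring
  rw [h3, h2, ← hN] at h0
  rw [inv_mul_eq_div, le_div_iff₀ hN0]
  linarith

/-- Revealing one more sign changes the conditional average by a first-level Walsh term. -/
theorem condAvg_insert (S : Finset ι) {j : ι} (hj : j ∉ S) (f : (ι → ℤˣ) → ℝ) (x : ι → ℤˣ) :
    condAvg (insert j S) f x =
      condAvg S f x + ((x j : ℤ) : ℝ) * signCoeff (fun η => f (S.piecewise x η)) j := by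
  set g : (ι → ℤˣ) → ℝ := fun η => f (S.piecewise x η) with hg
  have key : ∑ η, (1 + ((x j : ℤ) : ℝ) * ((η j : ℤ) : ℝ)) * g η =
      ∑ η, g (Function.update η j (x j)) := by
    have h1 := sum_flipSign j (fun η => (1 + ((x j : ℤ) : ℝ) * ((η j : ℤ) : ℝ)) * g η)
    have h2 : ∑ η, ((1 + ((x j : ℤ) : ℝ) * ((flipSign j η j : ℤ) : ℝ)) * g (flipSign j η) +
        (1 + ((x j : ℤ) : ℝ) * ((η j : ℤ) : ℝ)) * g η) =
        ∑ η, 2 * g (Function.update η j (x j)) := by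
      refine Finset.sum_congr rfl fun η _ => ?_
      rw [flipSign_same]
      rcases eq_or_ne (η j) (x j) with h | h
      · rw [← h, Function.update_eq_self, Units.val_neg, Int.cast_neg, mul_neg, cast_units_sq]
        ring
      · have h' : x j = -η j := by
          rcases Int.units_eq_one_or (η j) with h1 | h1 <;>
            rcases Int.units_eq_one_or (x j) with h2 | h2 <;> simp_all
        rw [h', Units.val_neg, Int.cast_neg, neg_mul_neg, cast_units_sq, neg_mul, cast_units_sq]
        simp only [flipSign]
        ring
    rw [Finset.sum_add_distrib, h1, ← Finset.mul_sum] at h2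
    linarith
  have e : ∀ η, f ((insert j S).piecewise x η) = g (Function.update η j (x j)) := by
    intro η
    rw [hg]
    congr 1
    rw [Finset.piecewise_insert]
    ext i
    by_cases hi : i = j
    · subst hi; simp [hj]
    · by_cases hi' : i ∈ S <;> simp [hi, hi']
  simp only [condAvg, e, ← key, signCoeff, smul_eq_mul]
  rw [mul_left_comm, ← mul_add]
  congr 1
  rw [Finset.mul_sum, ← Finset.sum_add_distrib]
  refine Finset.sum_congr rfl fun η _ => by ring

theorem condAvg_flipSign {V : Type*} [AddCommGroup V] [Module ℝ V] (S : Finset ι) {j : ι}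
    (hj : j ∉ S) (f : (ι → ℤˣ) → V) (x : ι → ℤˣ) :
    condAvg S f (flipSign j x) = condAvg S f x := by
  unfold condAvg
  congr 1
  refine Finset.sum_congr rfl fun η _ => ?_
  rw [piecewise_flipSign_left S hj]

theorem signCoeff_section_eq (S : Finset ι) {j : ι} (hj : j ∉ S) (f : (ι → ℤˣ) → ℝ)
    (x : ι → ℤˣ) :
    signCoeff (fun η => f (S.piecewise x η)) j =
      signCoeff (fun η => (fun y => 2⁻¹ * (f y - f (flipSign j y))) (S.piecewise x η)) j := by
  have h1 := sum_flipSign j (fun η => ((η j : ℤ) : ℝ) * f (S.piecewise x η))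
  simp only [flipSign_same, piecewise_flipSign_right S hj, Units.val_neg, Int.cast_neg,
    neg_mul, Finset.sum_neg_distrib] at h1
  have h2 : ∀ η : ι → ℤˣ, ((η j : ℤ) : ℝ) *
      (2⁻¹ * (f (S.piecewise x η) - f (flipSign j (S.piecewise x η)))) =
      2⁻¹ * (((η j : ℤ) : ℝ) * f (S.piecewise x η)) -
        2⁻¹ * (((η j : ℤ) : ℝ) * f (flipSign j (S.piecewise x η))) := fun η => by ring
  simp only [signCoeff, h2, Finset.sum_sub_distrib, ← Finset.mul_sum]
  congr 1
  linarith

theorem abs_units_cast (e : ℤˣ) : |((e : ℤ) : ℝ)| = 1 := by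
  rcases Int.units_eq_one_or e with rfl | rfl <;> simp

theorem sum_abs_signCoeff_rpow_le {p : ℝ} (hp : 1 ≤ p) (S : Finset ι) {j : ι} (hj : j ∉ S)
    (f : (ι → ℤˣ) → ℝ) :
    ∑ x, |signCoeff (fun η => f (S.piecewise x η)) j| ^ p ≤
      ∑ x, |2⁻¹ * (f x - f (flipSign j x))| ^ p := by
  rw [← sum_avg_piecewise S (fun x => |2⁻¹ * (f x - f (flipSign j x))| ^ p)]
  refine Finset.sum_le_sum fun x _ => ?_
  rw [signCoeff_section_eq S hj]
  refine (abs_card_inv_mul_sum_rpow_le _ hp).trans (le_of_eq ?_)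
  simp only [abs_mul, abs_units_cast, one_mul]

theorem sum_abs_condAvg_insert_rpow_le {p : ℝ} (hp : 2 ≤ p) (S : Finset ι) {j : ι} (hj : j ∉ S)
    (f : (ι → ℤˣ) → ℝ) :
    ∑ x, |condAvg (insert j S) f x| ^ p ≤
      ∑ x, (|condAvg S f x| ^ p + p * (p - 1) * 2 ^ p * (|condAvg S f x| ^ (p - 2) *
        signCoeff (fun η => f (S.piecewise x η)) j ^ 2)) +
      2 ^ p * ∑ x, |2⁻¹ * (f x - f (flipSign j x))| ^ p := by
  set c : (ι → ℤˣ) → ℝ := fun x => signCoeff (fun η => f (S.piecewise x η)) j with hc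
  have hcf : ∀ x, c (flipSign j x) = c x := fun x => by
    simp only [hc, piecewise_flipSign_left S hj]
  have h1 := sum_flipSign j (fun x => |condAvg (insert j S) f x| ^ p)
  have h2 : ∀ x, |condAvg (insert j S) f (flipSign j x)| ^ p + |condAvg (insert j S) f x| ^ p ≤
      2 * (|condAvg S f x| ^ p + p * (p - 1) * 2 ^ p * (|condAvg S f x| ^ (p - 2) * c x ^ 2)) +
        2 * (2 ^ p * |c x| ^ p) := by
    intro x
    have h3 := two_point_rpow_le hp (condAvg S f x) (c x)
    rw [condAvg_insert S hj, condAvg_insert S hj, condAvg_flipSign S hj, flipSign_same]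
    change |_ + _ * c (flipSign j x)| ^ p + |_ + _ * c x| ^ p ≤ _
    rw [hcf]
    rcases Int.units_eq_one_or (x j) with h | h <;> rw [h] <;> simp [← sub_eq_add_neg] <;> linarith
  have h4 := Finset.sum_le_sum fun x (_ : x ∈ Finset.univ) => h2 x
  rw [Finset.sum_add_distrib, Finset.sum_add_distrib, h1, ← Finset.mul_sum, ← Finset.mul_sum,
    ← Finset.mul_sum] at h4
  have h5 := sum_abs_signCoeff_rpow_le (p := p) (by linarith) S hj f
  have h6 : (0 : ℝ) ≤ 2 ^ p := by positivity
  have h7 := mul_le_mul_of_nonneg_left h5 h6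
  change 2 ^ p * ∑ x, |c x| ^ p ≤ _ at h7
  linarith

theorem sum_compl_condAvg_insert_rpow_le {p κ : ℝ} (hp : 2 ≤ p) (hκ : 0 < κ) (S : Finset ι)
    (hS : 0 < (Sᶜ).card) (f : (ι → ℤˣ) → ℝ) :
    ∑ j ∈ Sᶜ, ∑ x, |condAvg (insert j S) f x| ^ p ≤
      (Sᶜ).card * ((1 + κ⁻¹) * ∑ x, |condAvg S f x| ^ p +
        κ⁻¹ * (p * (p - 1) * 2 ^ p * κ / (Sᶜ).card) ^ (p / 2) * ∑ x, |f x| ^ p) +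
      2 ^ p * ∑ j ∈ Sᶜ, ∑ x, |2⁻¹ * (f x - f (flipSign j x))| ^ p := by
  set K : ℝ := p * (p - 1) * 2 ^ p with hK
  have hK0 : 0 ≤ K := by have : 0 ≤ p - 1 := by linarith
                         positivity
  set r : ℝ := ((Sᶜ).card : ℝ) with hr
  have hr0 : 0 < r := by rw [hr]; exact_mod_cast hS
  have h1 : ∑ j ∈ Sᶜ, ∑ x, |condAvg (insert j S) f x| ^ p ≤ _ :=
    Finset.sum_le_sum fun j hj => sum_abs_condAvg_insert_rpow_le hp S (Finset.mem_compl.1 hj) f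
  rw [Finset.sum_add_distrib, ← Finset.mul_sum] at h1
  refine h1.trans (add_le_add_left ?_ _)
  rw [Finset.sum_comm]
  have h2 : ∀ x, ∑ j ∈ Sᶜ, (|condAvg S f x| ^ p + K * (|condAvg S f x| ^ (p - 2) *
        signCoeff (fun η => f (S.piecewise x η)) j ^ 2)) ≤
      r * ((1 + κ⁻¹) * |condAvg S f x| ^ p + κ⁻¹ * (K * κ / r) ^ (p / 2) *
        ((Fintype.card (ι → ℤˣ) : ℝ)⁻¹ * ∑ η, |f (S.piecewise x η)| ^ p)) := by
    intro x
    set M := |condAvg S f x| with hM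
    set Q := (Fintype.card (ι → ℤˣ) : ℝ)⁻¹ * ∑ η, f (S.piecewise x η) ^ 2 with hQ
    have hQ0 : 0 ≤ Q := by positivity
    have b1 := sum_signCoeff_sq_le (fun η => f (S.piecewise x η)) Sᶜ
    have b2 : Q ^ (p / 2) ≤ (Fintype.card (ι → ℤˣ) : ℝ)⁻¹ * ∑ η, |f (S.piecewise x η)| ^ p := by
      have := abs_card_inv_mul_sum_rpow_le (fun η => f (S.piecewise x η) ^ 2)
        (s := p / 2) (by linarith)
      rw [← hQ, abs_of_nonneg hQ0] at this
      refine this.trans (le_of_eq ?_)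
      congr 1
      refine Finset.sum_congr rfl fun η _ => ?_
      rw [abs_pow, ← Real.rpow_natCast, ← Real.rpow_mul (abs_nonneg _)]
      congr 1; push_cast; ring
    have b3 := rpow_sub_two_mul_le hp (abs_nonneg (condAvg S f x))
      (Q := K * κ / r * Q) (by positivity)
    rw [← hM, Real.mul_rpow (by positivity) hQ0] at b3
    have b4 : (K * κ / r) ^ (p / 2) * Q ^ (p / 2) ≤ (K * κ / r) ^ (p / 2) *
      ((Fintype.card (ι → ℤˣ) : ℝ)⁻¹ * ∑ η, |f (S.piecewise x η)| ^ p) :=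
      mul_le_mul_of_nonneg_left b2 (by positivity)
    have hM0 : 0 ≤ M := abs_nonneg _
    rw [Finset.sum_add_distrib, Finset.sum_const, nsmul_eq_mul, ← Finset.mul_sum,
      ← Finset.mul_sum, ← hr]
    calc r * M ^ p + K * (M ^ (p - 2) *
          ∑ j ∈ Sᶜ, signCoeff (fun η => f (S.piecewise x η)) j ^ 2)
        ≤ r * M ^ p + K * (M ^ (p - 2) * Q) := by gcongr
      _ = r * (M ^ p + κ⁻¹ * (M ^ (p - 2) * (K * κ / r * Q))) := by field_simp
      _ ≤ r * (M ^ p + κ⁻¹ * (M ^ p + (K * κ / r) ^ (p / 2) *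
          ((Fintype.card (ι → ℤˣ) : ℝ)⁻¹ * ∑ η, |f (S.piecewise x η)| ^ p))) := by
          gcongr; linarith
      _ = _ := by ring
  refine (Finset.sum_le_sum fun x _ => h2 x).trans (le_of_eq ?_)
  rw [← Finset.mul_sum, Finset.sum_add_distrib, ← Finset.mul_sum, ← Finset.mul_sum,
    sum_avg_piecewise S (fun x => |f x| ^ p)]

end SignCube

section LpSpaceLemmas

open MeasureTheory

theorem LpSpace_norm_rpow {p : ℝ} (hp : 1 ≤ p) (g : LpSpace p) {h : ℝ → ℝ}
    (hg : (g : ℝ → ℝ) =ᵐ[volume] h) :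
    Integrable (fun s => |h s| ^ p) ∧ ∫ s, |h s| ^ p = ‖g‖ ^ p := by
  have hp0 : 0 < p := by linarith
  have hne0 : ENNReal.ofReal p ≠ 0 := by simpa using hp0
  have htr : (ENNReal.ofReal p).toReal = p := ENNReal.toReal_ofReal hp0.le
  have hm := Lp.memLp g
  have e : (fun s => |h s| ^ p) =ᵐ[volume] fun s => ‖(g : ℝ → ℝ) s‖ ^ p := by
    filter_upwards [hg] with s hs
    rw [hs, Real.norm_eq_abs]
  have hi := hm.integrable_norm_rpow hne0 ENNReal.ofReal_ne_top
  have hn := hm.eLpNorm_eq_integral_rpow_norm hne0 ENNReal.ofReal_ne_top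
  rw [htr] at hi hn
  refine ⟨hi.congr e.symm, ?_⟩
  rw [integral_congr_ae e, Lp.norm_def, hn, ENNReal.toReal_ofReal (by positivity),
    ← Real.rpow_mul (by positivity), inv_mul_cancel₀ hp0.ne', Real.rpow_one]

variable {ι : Type*} [Fintype ι] [DecidableEq ι]

theorem coeFn_condAvg {p : ℝ} [Fact (1 ≤ ENNReal.ofReal p)] (S : Finset ι)
    (u : (ι → ℤˣ) → LpSpace p) (x : ι → ℤˣ) :
    ((condAvg S u x : LpSpace p) : ℝ → ℝ) =ᵐ[volume] fun s => condAvg S (fun y => u y s) x := by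
  unfold condAvg
  filter_upwards [Lp.coeFn_smul (Fintype.card (ι → ℤˣ) : ℝ)⁻¹ (∑ η, u (S.piecewise x η)),
    Lp.coeFn_finsetSum Finset.univ (fun η => u (S.piecewise x η))] with s h1 h2
  rw [h1, Pi.smul_apply, h2, Finset.sum_apply]

theorem coeFn_half_sub {p : ℝ} [Fact (1 ≤ ENNReal.ofReal p)] (a b : LpSpace p) :
    (((2 : ℝ)⁻¹ • (a - b) : LpSpace p) : ℝ → ℝ) =ᵐ[volume] fun s => 2⁻¹ * (a s - b s) := by
  filter_upwards [Lp.coeFn_smul (2 : ℝ)⁻¹ (a - b), Lp.coeFn_sub a b] with s h1 h2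
  rw [h1, Pi.smul_apply, h2, Pi.sub_apply, smul_eq_mul]

theorem sum_compl_norm_condAvg_insert_rpow_le {p κ : ℝ} [Fact (1 ≤ ENNReal.ofReal p)]
    (hp : 2 ≤ p) (hκ : 0 < κ) (S : Finset ι)
    (hS : 0 < (Sᶜ).card) (u : (ι → ℤˣ) → LpSpace p) :
    ∑ j ∈ Sᶜ, ∑ x, ‖condAvg (insert j S) u x‖ ^ p ≤
      (Sᶜ).card * ((1 + κ⁻¹) * ∑ x, ‖condAvg S u x‖ ^ p +
        κ⁻¹ * (p * (p - 1) * 2 ^ p * κ / (Sᶜ).card) ^ (p / 2) * ∑ x, ‖u x‖ ^ p) +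
      2 ^ p * ∑ j ∈ Sᶜ, ∑ x, ‖(2 : ℝ)⁻¹ • (u x - u (flipSign j x))‖ ^ p := by
  have hp1 : 1 ≤ p := by linarith
  have A := fun (T : Finset ι) x => LpSpace_norm_rpow hp1 _ (coeFn_condAvg T u x)
  have B := fun x => LpSpace_norm_rpow hp1 (u x) (Filter.EventuallyEq.rfl)
  have C := fun j x => LpSpace_norm_rpow hp1 _ (coeFn_half_sub (u x) (u (flipSign j x)))
  simp only [← (A _ _).2, ← (B _).2, ← (C _ _).2]
  have i1 : ∀ j, Integrable (fun s => ∑ x, |condAvg (insert j S) (fun y => u y s) x| ^ p) :=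
    fun j => integrable_finsetSum _ fun x _ => (A _ x).1
  have i2 : Integrable (fun s => ∑ x, |condAvg S (fun y => u y s) x| ^ p) :=
    integrable_finsetSum _ fun x _ => (A _ x).1
  have i3 : Integrable (fun s => ∑ x, |u x s| ^ p) :=
    integrable_finsetSum _ fun x _ => (B x).1
  have i4 : ∀ j, Integrable (fun s => ∑ x, |2⁻¹ * (u x s - u (flipSign j x) s)| ^ p) :=
    fun j => integrable_finsetSum _ fun x _ => (C j x).1
  have e1 : ∀ j, ∑ x, ∫ s, |condAvg (insert j S) (fun y => u y s) x| ^ p =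
      ∫ s, ∑ x, |condAvg (insert j S) (fun y => u y s) x| ^ p :=
    fun j => (integral_finsetSum _ fun x _ => (A _ x).1).symm
  have e2 : ∑ x, ∫ s, |condAvg S (fun y => u y s) x| ^ p =
      ∫ s, ∑ x, |condAvg S (fun y => u y s) x| ^ p :=
    (integral_finsetSum _ fun x _ => (A _ x).1).symm
  have e3 : ∑ x, ∫ s, |u x s| ^ p = ∫ s, ∑ x, |u x s| ^ p :=
    (integral_finsetSum _ fun x _ => (B x).1).symm
  have e4 : ∀ j, ∑ x, ∫ s, |2⁻¹ * (u x s - u (flipSign j x) s)| ^ p =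
      ∫ s, ∑ x, |2⁻¹ * (u x s - u (flipSign j x) s)| ^ p :=
    fun j => (integral_finsetSum _ fun x _ => (C j x).1).symm
  simp only [e1, e2, e3, e4]
  rw [← integral_finsetSum _ fun j _ => i1 j, ← integral_finsetSum _ fun j _ => i4 j,
    ← integral_const_mul, ← integral_const_mul, ← integral_add (i2.const_mul _) (i3.const_mul _),
    ← integral_const_mul, ← integral_const_mul, ← integral_add]
  · refine integral_mono (integrable_finsetSum _ fun j _ => i1 j) ?_ fun s => ?_
    · exact (((i2.const_mul _).add (i3.const_mul _)).const_mul _).add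
        ((integrable_finsetSum _ fun j _ => i4 j).const_mul _)
    · exact sum_compl_condAvg_insert_rpow_le hp hκ S hS (fun y => u y s)
  · exact ((i2.const_mul _).add (i3.const_mul _)).const_mul _
  · exact (integrable_finsetSum _ fun j _ => i4 j).const_mul _

end LpSpaceLemmas

section FiniteLp

open MeasureTheory

/-- Finite-dimensional `ℓ_p` embeds isometrically into `L_p(ℝ)`. -/
theorem exists_lp_isometry {κ : Type*} [Fintype κ] {p : ℝ} [Fact (1 ≤ ENNReal.ofReal p)]
    (hp : 1 ≤ p) :
    ∃ T : (κ → ℝ) → LpSpace p, ∀ a b, ‖T a - T b‖ ^ p = ∑ i, |a i - b i| ^ p := by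
  classical
  have hp0 : 0 < p := by linarith
  let e := Fintype.equivFin κ
  let I : κ → Set ℝ := fun i => Set.Ico ((e i : ℕ) : ℝ) ((e i : ℕ) + 1)
  have hI : ∀ i, MeasurableSet (I i) := fun i => measurableSet_Ico
  have hv : ∀ i, volume (I i) = 1 := fun i => by simp [I]
  have hv' : ∀ i, volume (I i) ≠ ⊤ := fun i => by simp [hv]
  have hdisj : ∀ i j s, s ∈ I i → s ∈ I j → i = j := by
    intro i j s hi hj
    apply e.injective
    apply Fin.ext
    have h1 : ((e i : ℕ) : ℝ) < (e j : ℕ) + 1 := hi.1.trans_lt hj.2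
    have h2 : ((e j : ℕ) : ℝ) < (e i : ℕ) + 1 := hj.1.trans_lt hi.2
    norm_cast at h1 h2
    omega
  let b : κ → LpSpace p := fun i => indicatorConstLp (ENNReal.ofReal p) (hI i) (hv' i) (1 : ℝ)
  refine ⟨fun a => ∑ i, a i • b i, fun a a' => ?_⟩
  rw [← Finset.sum_sub_distrib]
  simp only [← sub_smul]
  set c : κ → ℝ := fun i => a i - a' i
  change ‖∑ i, c i • b i‖ ^ p = ∑ i, |c i| ^ p
  have hco : ((∑ i, c i • b i : LpSpace p) : ℝ → ℝ) =ᵐ[volume]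
      fun s => ∑ i, c i * (I i).indicator (fun _ => (1 : ℝ)) s := by
    have h1 : ∀ᵐ s, ∀ i, ((c i • b i : LpSpace p) : ℝ → ℝ) s =
        c i * (I i).indicator (fun _ => (1 : ℝ)) s := by
      rw [ae_all_iff]
      intro i
      filter_upwards [Lp.coeFn_smul (c i) (b i),
        indicatorConstLp_coeFn (p := ENNReal.ofReal p) (hs := hI i) (hμs := hv' i) (c := (1 : ℝ))]
        with s h1 h2
      rw [h1, Pi.smul_apply, smul_eq_mul, h2]
    filter_upwards [h1, Lp.coeFn_finsetSum Finset.univ (fun i => c i • b i)] with s h2 h3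
    rw [h3, Finset.sum_apply]
    exact Finset.sum_congr rfl fun i _ => h2 i
  rw [← (LpSpace_norm_rpow hp _ hco).2]
  have hpt : ∀ s, |∑ i, c i * (I i).indicator (fun _ => (1 : ℝ)) s| ^ p =
      ∑ i, (I i).indicator (fun _ => |c i| ^ p) s := by
    intro s
    by_cases h : ∃ i, s ∈ I i
    · obtain ⟨i, hi⟩ := h
      have hne : ∀ j, j ≠ i → s ∉ I j := fun j hj hs => hj (hdisj _ _ _ hs hi)
      rw [Finset.sum_eq_single i, Finset.sum_eq_single i]
      · simp [hi]
      · intro j _ hj; simp [hne j hj]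
      · simp
      · intro j _ hj; simp [hne j hj]
      · simp
    · push Not at h
      simp [h, Real.zero_rpow hp0.ne']
  simp only [hpt]
  rw [integral_finsetSum]
  · refine Finset.sum_congr rfl fun i _ => ?_
    rw [integral_indicator_const _ (hI i)]
    simp [Measure.real, hv]
  · intro i _
    exact (integrable_indicator_iff (hI i)).2 (integrableOn_const (hv' i))

theorem exists_embedding_of_finite {X κ : Type*} [Fintype κ] {p : ℝ} (hp : 1 ≤ p)
    {d : X → X → ℝ} (hd : ∀ x y, 0 ≤ d x y) (g : X → κ → ℝ) {A B : ℝ} (hA : 0 < A) (hB : 0 ≤ B)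
    (hlow : ∀ x y, (A * d x y) ^ p ≤ ∑ i, |g x i - g y i| ^ p)
    (hup : ∀ x y, ∑ i, |g x i - g y i| ^ p ≤ (B * d x y) ^ p) :
    ∃ f : X → LpSpace p, ∀ x y, d x y ≤ ‖f x - f y‖ ∧ ‖f x - f y‖ ≤ B / A * d x y := by
  have hp0 : 0 < p := by linarith
  have : Fact (1 ≤ ENNReal.ofReal p) := ⟨by simpa using hp⟩
  obtain ⟨T, hT⟩ := exists_lp_isometry (κ := κ) hp
  refine ⟨fun x => A⁻¹ • T (g x), fun x y => ?_⟩
  rw [← smul_sub, norm_smul, Real.norm_of_nonneg (by positivity), inv_mul_eq_div,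
    le_div_iff₀ hA, div_mul_eq_mul_div]
  have h1 := hlow x y
  have h2 := hup x y
  rw [← hT, Real.rpow_le_rpow_iff (mul_nonneg hA.le (hd _ _)) (norm_nonneg _) hp0] at h1
  rw [← hT, Real.rpow_le_rpow_iff (norm_nonneg _) (mul_nonneg hB (hd _ _)) hp0] at h2
  refine ⟨by linarith, by gcongr⟩

end FiniteLp

theorem one_add_inv_pow_le_three (k : ℕ) : (1 + (k : ℝ)⁻¹) ^ k ≤ 3 := by
  rcases Nat.eq_zero_or_pos k with rfl | hk
  · simp
  · have h1 : 1 + (k : ℝ)⁻¹ ≤ Real.exp ((k : ℝ)⁻¹) := by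
      rw [add_comm]; exact Real.add_one_le_exp _
    calc (1 + (k : ℝ)⁻¹) ^ k ≤ Real.exp ((k : ℝ)⁻¹) ^ k := by gcongr
      _ = Real.exp 1 := by
        rw [← Real.exp_nat_mul, mul_inv_cancel₀ (by exact_mod_cast hk.ne')]
      _ ≤ 3 := by linarith [Real.exp_one_lt_d9]

/-- A form of the `X_p` inequality on the sign cube: some set `S` of `k` coordinates makes the
conditional averages given `S` small. -/
theorem exists_finset_condAvg_small {ι γ : Type*} [Fintype ι] [DecidableEq ι] [Fintype γ] {p : ℝ}
    [Fact (1 ≤ ENNReal.ofReal p)] (hp : 2 ≤ p) (u : γ → (ι → ℤˣ) → LpSpace p)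
    (hmean : ∀ y, ∑ x, u y x = 0) {R D : ℝ} (hR : ∀ y x, ‖u y x‖ ≤ R)
    (hD : ∀ y x j, ‖(2 : ℝ)⁻¹ • (u y x - u y (flipSign j x))‖ ≤ D) (hR0 : 0 ≤ R) (hD0 : 0 ≤ D)
    {k : ℕ} (hk : 0 < k) (hkn : 2 * k ≤ Fintype.card ι) :
    ∃ S : Finset ι, S.card = k ∧ ∑ y, ∑ x, ‖condAvg S (u y) x‖ ^ p ≤
      (Fintype.card γ * Fintype.card (ι → ℤˣ) : ℝ) * (3 * ((p * (p - 1) * 2 ^ p * k /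
        (Fintype.card ι / 2)) ^ (p / 2) * R ^ p + k * (2 ^ p * D ^ p))) := by
  have hp0 : 0 < p := by linarith
  have hk0 : (0 : ℝ) < k := by exact_mod_cast hk
  have hn0 : (0 : ℝ) < Fintype.card ι := by exact_mod_cast (by omega : 0 < Fintype.card ι)
  set W : ℝ := (Fintype.card γ * Fintype.card (ι → ℤˣ) : ℝ) with hW
  set L : ℝ := (p * (p - 1) * 2 ^ p * k / (Fintype.card ι / 2)) ^ (p / 2) with hL
  have hbase : 0 ≤ p * (p - 1) * 2 ^ p * (k : ℝ) := by
    have : 0 ≤ p - 1 := by linarith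
    positivity
  have hL0 : 0 ≤ L := Real.rpow_nonneg (by positivity) _
  set B : ℝ := (k : ℝ)⁻¹ * L * R ^ p + 2 ^ p * D ^ p with hB
  have hB0 : 0 ≤ B := by positivity
  have hW0 : 0 ≤ W := by positivity
  have hconst : ∀ v : ℝ, ∑ _y : γ, ∑ _x : ι → ℤˣ, v = W * v := by
    intro v; simp [hW]; ring
  have main : ∀ i : ℕ, i ≤ k → ∃ S : Finset ι, S.card = i ∧
      ∑ y, ∑ x, ‖condAvg S (u y) x‖ ^ p ≤ W * ((1 + (k : ℝ)⁻¹) ^ i * (i * B)) := by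
    intro i
    induction i with
    | zero =>
      intro _
      refine ⟨∅, rfl, ?_⟩
      have : ∀ y x, condAvg ∅ (u y) x = 0 := fun y x => by simp [condAvg, hmean]
      simp [this, Real.zero_rpow hp0.ne']
    | succ i ih =>
      intro hi
      obtain ⟨S, hSc, hS⟩ := ih (by omega)
      have hr : (Sᶜ).card = Fintype.card ι - i := by rw [Finset.card_compl, hSc]
      have hrpos : 0 < (Sᶜ).card := by omega
      have hr0 : (0 : ℝ) < (Sᶜ).card := by exact_mod_cast hrpos
      have hrn : (Fintype.card ι / 2 : ℝ) ≤ (Sᶜ).card := by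
        have : Fintype.card ι ≤ 2 * (Sᶜ).card := by omega
        have : (Fintype.card ι : ℝ) ≤ 2 * (Sᶜ).card := by exact_mod_cast this
        linarith
      have hstep := Finset.sum_le_sum fun y (_ : y ∈ Finset.univ) =>
        sum_compl_norm_condAvg_insert_rpow_le hp hk0 S hrpos (u y)
      have hu : ∑ y, ∑ x, ‖u y x‖ ^ p ≤ W * R ^ p := by
        rw [← hconst]
        exact Finset.sum_le_sum fun y _ => Finset.sum_le_sum fun x _ =>
          Real.rpow_le_rpow (norm_nonneg _) (hR y x) hp0.le
      have hdj : ∀ j, ∑ y, ∑ x, ‖(2 : ℝ)⁻¹ • (u y x - u y (flipSign j x))‖ ^ p ≤ W * D ^ p := by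
        intro j
        rw [← hconst]
        exact Finset.sum_le_sum fun y _ => Finset.sum_le_sum fun x _ =>
          Real.rpow_le_rpow (norm_nonneg _) (hD y x j) hp0.le
      have hdj' : ∑ y, ∑ j ∈ Sᶜ, ∑ x, ‖(2 : ℝ)⁻¹ • (u y x - u y (flipSign j x))‖ ^ p ≤
          (Sᶜ).card * (W * D ^ p) := by
        rw [Finset.sum_comm, ← nsmul_eq_mul]
        exact Finset.sum_le_card_nsmul _ _ _ fun j _ => hdj j
      have hLr : (p * (p - 1) * 2 ^ p * k / (Sᶜ).card) ^ (p / 2) ≤ L := by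
        refine Real.rpow_le_rpow (by positivity) ?_ (by positivity)
        gcongr
      have hLr0 : 0 ≤ (p * (p - 1) * 2 ^ p * k / (Sᶜ).card : ℝ) ^ (p / 2) :=
        Real.rpow_nonneg (by positivity) _
      rw [Finset.sum_comm, Finset.sum_add_distrib, ← Finset.mul_sum, ← Finset.mul_sum,
        Finset.sum_add_distrib, ← Finset.mul_sum, ← Finset.mul_sum] at hstep
      have hfin : ∑ j ∈ Sᶜ, ∑ y, ∑ x, ‖condAvg (insert j S) (u y) x‖ ^ p ≤
          ∑ _j ∈ Sᶜ, W * ((1 + (k : ℝ)⁻¹) ^ (i + 1) * ((i + 1 : ℕ) * B)) := by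
        refine hstep.trans ?_
        rw [Finset.sum_const, nsmul_eq_mul]
        calc _ ≤ (Sᶜ).card * ((1 + (k : ℝ)⁻¹) * (W * ((1 + (k : ℝ)⁻¹) ^ i * (i * B))) +
              (k : ℝ)⁻¹ * L * (W * R ^ p)) + 2 ^ p * ((Sᶜ).card * (W * D ^ p)) := by
              gcongr
          _ = (Sᶜ).card * (W * ((1 + (k : ℝ)⁻¹) ^ (i + 1) * (i * B) + 1 * B)) := by
              rw [hB, pow_succ]; ring
          _ ≤ (Sᶜ).card * (W * ((1 + (k : ℝ)⁻¹) ^ (i + 1) * (i * B) +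
              (1 + (k : ℝ)⁻¹) ^ (i + 1) * B)) := by
              gcongr
              exact one_le_pow₀ (by linarith [inv_nonneg.2 hk0.le])
          _ = _ := by push_cast; ring
      obtain ⟨j, hj, hjle⟩ := Finset.exists_le_of_sum_le (Finset.card_pos.1 hrpos) hfin
      exact ⟨insert j S, by rw [Finset.card_insert_of_notMem (Finset.mem_compl.1 hj), hSc], hjle⟩
  obtain ⟨S, hSc, hS⟩ := main k le_rfl
  refine ⟨S, hSc, hS.trans ?_⟩
  have e : (k : ℝ) * B = L * R ^ p + k * (2 ^ p * D ^ p) := by rw [hB]; field_simp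
  rw [e]
  gcongr
  exact one_add_inv_pow_le_three k

theorem sum_norm_add_nsmul_sub_rpow_le {G V : Type*} [AddCommGroup G] [Fintype G]
    [SeminormedAddCommGroup V] (A : G → V) (w : G) (m : ℕ) {p : ℝ} (hp : 1 ≤ p) :
    ∑ y, ‖A (y + m • w) - A y‖ ^ p ≤ (m : ℝ) ^ p * ∑ y, ‖A (y + w) - A y‖ ^ p := by
  have hp0 : 0 < p := by linarith
  have h1 : ∀ y, ‖A (y + m • w) - A y‖ ^ p ≤
      (m : ℝ) ^ (p - 1) * ∑ i ∈ Finset.range m, ‖A (y + i • w + w) - A (y + i • w)‖ ^ p := by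
    intro y
    have e : A (y + m • w) - A y = ∑ i ∈ Finset.range m, (A (y + i • w + w) - A (y + i • w)) := by
      have := Finset.sum_range_sub (fun i => A (y + i • w)) m
      simp only [zero_smul, add_zero] at this
      rw [← this]
      refine Finset.sum_congr rfl fun i _ => ?_
      rw [succ_nsmul, add_assoc]
    have h := Real.rpow_sum_le_const_mul_sum_rpow (Finset.range m)
      (fun i => ‖A (y + i • w + w) - A (y + i • w)‖) hp
    simp only [abs_norm, Finset.card_range] at h
    refine le_trans (Real.rpow_le_rpow (norm_nonneg _) ?_ hp0.le) h
    rw [e]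
    exact norm_sum_le _ _
  refine (Finset.sum_le_sum fun y _ => h1 y).trans ?_
  rw [← Finset.mul_sum, Finset.sum_comm]
  have h2 : ∀ i ∈ Finset.range m, ∑ y, ‖A (y + i • w + w) - A (y + i • w)‖ ^ p =
      ∑ y, ‖A (y + w) - A y‖ ^ p := fun i _ =>
    Equiv.sum_comp (Equiv.addRight (i • w)) (fun y => ‖A (y + w) - A y‖ ^ p)
  rw [Finset.sum_congr rfl h2, Finset.sum_const, Finset.card_range, nsmul_eq_mul, ← mul_assoc]
  rcases Nat.eq_zero_or_pos m with rfl | hm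
  · simp [Real.zero_rpow hp0.ne']
  · rw [← Real.rpow_add_one (by positivity)]
    simp

theorem rpow_add_three_le {a b c p : ℝ} (ha : 0 ≤ a) (hb : 0 ≤ b) (hc : 0 ≤ c) (hp : 0 < p) :
    (a + b + c) ^ p ≤ 3 ^ p * (a ^ p + b ^ p + c ^ p) := by
  have h1 : (a + b + c) ^ p ≤ (3 * max a (max b c)) ^ p := by
    refine Real.rpow_le_rpow (by positivity) ?_ hp.le
    have := le_max_left a (max b c)
    have h2 := le_max_right a (max b c)
    have := le_max_left b c
    have := le_max_right b c
    linarith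
  refine h1.trans ?_
  rw [Real.mul_rpow (by norm_num) (by positivity)]
  gcongr
  have := Real.rpow_nonneg ha p
  have := Real.rpow_nonneg hb p
  have := Real.rpow_nonneg hc p
  rcases max_choice a (max b c) with h | h <;> rw [h]
  · linarith
  · rcases max_choice b c with h | h <;> rw [h] <;> linarith

/-- A sign vector as an element of `(ℤ/N)^n`, set to zero outside of `S`. -/
def signVec {n : ℕ} (N : ℕ) (S : Finset (Fin n)) (x : Fin n → ℤˣ) : Fin n → ZMod N :=
  fun i => if i ∈ S then ((x i : ℤ) : ZMod N) else 0

theorem signVec_neg {n N : ℕ} (S : Finset (Fin n)) (x : Fin n → ℤˣ) :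
    signVec N S (-x) = -signVec N S x := by
  ext i
  by_cases h : i ∈ S <;> simp [signVec, h]

theorem signVec_piecewise {n N : ℕ} (S : Finset (Fin n)) (x η : Fin n → ℤˣ) :
    signVec N univ (S.piecewise x η) = signVec N S x + signVec N Sᶜ η := by
  ext i
  by_cases h : i ∈ S <;> simp [signVec, h]

theorem two_mul_nsmul_signVec {n m : ℕ} (S : Finset (Fin n)) (x : Fin n → ℤˣ) :
    (2 * m) • signVec (4 * m) S x = (2 * m) • signVec (4 * m) S 1 := by
  ext i
  by_cases h : i ∈ S
  · rcases Int.units_eq_one_or (x i) with hx | hx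
    · simp [signVec, h, hx]
    · have h4 : ((4 * m : ℕ) : ZMod (4 * m)) = 0 := ZMod.natCast_self _
      push_cast at h4
      simp [signVec, h, hx]
      linear_combination -h4
  · simp [signVec, h]

theorem signVec_flipSign {n N : ℕ} (j : Fin n) (x : Fin n → ℤˣ) :
    signVec N univ x = signVec N univ (flipSign j x) + Pi.single j 2 ∨
      signVec N univ (flipSign j x) = signVec N univ x + Pi.single j 2 := by
  rcases Int.units_eq_one_or (x j) with hx | hx
  · left
    ext i
    by_cases h : i = j
    · subst h; simp [signVec, flipSign_same, hx]; ring
    · simp [signVec, flipSign_of_ne h, h]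
  · right
    ext i
    by_cases h : i = j
    · subst h; simp [signVec, flipSign_same, hx]; ring
    · simp [signVec, flipSign_of_ne h, h]

/-- The metric `X_p` inequality for functions on a discrete torus. -/
theorem exists_finset_sum_norm_shift_le {n m k : ℕ} [NeZero (4 * m)] {p : ℝ} (hp : 2 ≤ p)
    [Fact (1 ≤ ENNReal.ofReal p)]
    (F : (Fin n → ZMod (4 * m)) → LpSpace p) {R D : ℝ} (hR0 : 0 ≤ R) (hD0 : 0 ≤ D)
    (hR : ∀ y S x, ‖F (y + signVec (4 * m) S x) - F y‖ ≤ R)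
    (hD : ∀ y j, ‖F (y + Pi.single j 2) - F y‖ ≤ 2 * D) (hk : 0 < k) (hkn : 2 * k ≤ n) :
    ∃ S : Finset (Fin n), S.card = k ∧
      ∑ y, ‖F (y + (2 * m) • signVec (4 * m) S 1) - F y‖ ^ p ≤
        Fintype.card (Fin n → ZMod (4 * m)) * (3 ^ p * (2 * R ^ p + (m : ℝ) ^ p * (2 ^ p * 2 *
          (3 * ((p * (p - 1) * 2 ^ p * k / (n / 2)) ^ (p / 2) * (2 * R) ^ p +
            k * (2 ^ p * D ^ p)))))) := by
  have hp0 : 0 < p := by linarith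
  set N : ℝ := (Fintype.card (Fin n → ℤˣ) : ℝ) with hN
  have hN0 : 0 < N := by rw [hN]; exact_mod_cast Fintype.card_pos
  let av : (Fin n → ZMod (4 * m)) → LpSpace p :=
    fun y => N⁻¹ • ∑ x, F (y + signVec (4 * m) univ x)
  have havg : ∀ (y : Fin n → ZMod (4 * m)) (T : Finset (Fin n)) (z : LpSpace p) (K : ℝ),
      (∀ x, ‖F (y + signVec (4 * m) T x) - z‖ ≤ K) →
      ‖N⁻¹ • ∑ x, F (y + signVec (4 * m) T x) - z‖ ≤ K := by
    intro y T z K h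
    have e : N⁻¹ • ∑ x, F (y + signVec (4 * m) T x) - z =
        N⁻¹ • ∑ x, (F (y + signVec (4 * m) T x) - z) := by
      rw [Finset.sum_sub_distrib, smul_sub, Finset.sum_const, Finset.card_univ,
        ← Nat.cast_smul_eq_nsmul ℝ, smul_smul, ← hN, inv_mul_cancel₀ hN0.ne', one_smul]
    rw [e, norm_smul, Real.norm_of_nonneg (by positivity)]
    calc N⁻¹ * ‖∑ x, (F (y + signVec (4 * m) T x) - z)‖ ≤ N⁻¹ * (N * K) := by
          gcongr
          refine (norm_sum_le _ _).trans ((Finset.sum_le_sum fun x _ => h x).trans ?_)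
          simp [hN]
      _ = K := by field_simp
  let u : (Fin n → ZMod (4 * m)) → (Fin n → ℤˣ) → LpSpace p :=
    fun y x => F (y + signVec (4 * m) univ x) - av y
  obtain ⟨S, hSc, hS⟩ := exists_finset_condAvg_small hp u
    (fun y => by
      simp only [u, av]
      rw [Finset.sum_sub_distrib, Finset.sum_const, Finset.card_univ,
        ← Nat.cast_smul_eq_nsmul ℝ, smul_smul, ← hN, mul_inv_cancel₀ hN0.ne', one_smul, sub_self])
    (R := 2 * R) (D := D)
    (fun y x => by
      simp only [u, av]
      have h1 := havg y univ (F y) R fun x => hR y univ x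
      have h2 := hR y univ x
      rw [norm_sub_rev] at h1
      have := norm_sub_le_norm_sub_add_norm_sub (F (y + signVec (4 * m) univ x)) (F y)
        (N⁻¹ • ∑ x, F (y + signVec (4 * m) univ x))
      linarith)
    (fun y x j => by
      rw [norm_smul, Real.norm_of_nonneg (by norm_num), sub_sub_sub_cancel_right]
      have : ‖F (y + signVec (4 * m) univ x) - F (y + signVec (4 * m) univ (flipSign j x))‖ ≤
          2 * D := by
        rcases signVec_flipSign (N := 4 * m) j x with h | h
        · rw [h, ← add_assoc]; exact hD _ j
        · rw [h, ← add_assoc, norm_sub_rev]; exact hD _ j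
      linarith)
    (by linarith) hD0 hk (by simpa using hkn)
  refine ⟨S, hSc, ?_⟩
  rw [← hN, Fintype.card_fin] at hS
  set Φ : ℝ := 3 * ((p * (p - 1) * 2 ^ p * k / (n / 2)) ^ (p / 2) * (2 * R) ^ p +
            k * (2 ^ p * D ^ p)) with hΦ
  set g : ℝ := (Fintype.card (Fin n → ZMod (4 * m)) : ℝ) with hg
  let A : (Fin n → ZMod (4 * m)) → LpSpace p :=
    fun y => N⁻¹ • ∑ η, F (y + signVec (4 * m) Sᶜ η)
  have hAF : ∀ y, ‖A y - F y‖ ≤ R := fun y => havg y Sᶜ (F y) R fun x => hR y Sᶜ x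
  have hAc : ∀ y x, A (y + signVec (4 * m) S x) = condAvg S (u y) x + av y := by
    intro y x
    simp only [condAvg, u, ← hN]
    rw [Finset.sum_sub_distrib, smul_sub, Finset.sum_const, Finset.card_univ,
        ← Nat.cast_smul_eq_nsmul ℝ, smul_smul, ← hN, inv_mul_cancel₀ hN0.ne', one_smul,
        sub_add_cancel]
    simp only [A, signVec_piecewise, add_assoc]
  have htel : ∀ x, ∑ y, ‖A (y + (2 * m) • signVec (4 * m) S 1) - A y‖ ^ p ≤
      (m : ℝ) ^ p * ∑ y, 2 ^ p * (‖condAvg S (u y) x‖ ^ p + ‖condAvg S (u y) (-x)‖ ^ p) := by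
    intro x
    have h := sum_norm_add_nsmul_sub_rpow_le A (2 • signVec (4 * m) S x) m (p := p) (by linarith)
    rw [smul_smul, mul_comm m 2, two_mul_nsmul_signVec] at h
    refine h.trans ?_
    refine mul_le_mul_of_nonneg_left ?_ (by positivity)
    rw [← Equiv.sum_comp (Equiv.addRight (-signVec (4 * m) S x))
      (fun y => ‖A (y + 2 • signVec (4 * m) S x) - A y‖ ^ p)]
    refine Finset.sum_le_sum fun y _ => ?_
    simp only [Equiv.coe_addRight]
    have e : y + -signVec (4 * m) S x + 2 • signVec (4 * m) S x = y + signVec (4 * m) S x := by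
      rw [two_nsmul]; abel
    rw [e, ← signVec_neg, hAc, hAc, add_sub_add_right_eq_sub]
    have h3 := norm_sub_le (condAvg S (u y) x) (condAvg S (u y) (-x))
    have h4 : ‖condAvg S (u y) x - condAvg S (u y) (-x)‖ ≤
        2 * max ‖condAvg S (u y) x‖ ‖condAvg S (u y) (-x)‖ := by
      have := le_max_left ‖condAvg S (u y) x‖ ‖condAvg S (u y) (-x)‖
      have := le_max_right ‖condAvg S (u y) x‖ ‖condAvg S (u y) (-x)‖
      linarith
    refine (Real.rpow_le_rpow (norm_nonneg _) h4 hp0.le).trans ?_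
    rw [Real.mul_rpow (by norm_num) (by positivity)]
    gcongr
    have : 0 ≤ ‖condAvg S (u y) x‖ ^ p := by positivity
    have : 0 ≤ ‖condAvg S (u y) (-x)‖ ^ p := by positivity
    rcases max_choice ‖condAvg S (u y) x‖ ‖condAvg S (u y) (-x)‖ with h | h <;> rw [h] <;> linarith
  have hmid : ∑ y, ‖A (y + (2 * m) • signVec (4 * m) S 1) - A y‖ ^ p ≤
      g * ((m : ℝ) ^ p * (2 ^ p * 2 * Φ)) := by
    have h := Finset.sum_le_sum fun x (_ : x ∈ univ) => htel x
    rw [Finset.sum_const, Finset.card_univ, nsmul_eq_mul, ← hN, ← Finset.mul_sum,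
      Finset.sum_comm] at h
    simp only [← Finset.mul_sum, Finset.sum_add_distrib] at h
    have hneg : ∀ y, ∑ x, ‖condAvg S (u y) (-x)‖ ^ p = ∑ x, ‖condAvg S (u y) x‖ ^ p := fun y =>
      Equiv.sum_comp (Equiv.neg (Fin n → ℤˣ)) (fun x => ‖condAvg S (u y) x‖ ^ p)
    simp only [hneg] at h
    refine le_of_mul_le_mul_left (h.trans ?_) hN0
    calc _ ≤ (m : ℝ) ^ p * (2 ^ p * (g * N * Φ + g * N * Φ)) := by gcongr
      _ = _ := by ring
  have hpt : ∀ y, ‖F (y + (2 * m) • signVec (4 * m) S 1) - F y‖ ^ p ≤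
      3 ^ p * (R ^ p + ‖A (y + (2 * m) • signVec (4 * m) S 1) - A y‖ ^ p + R ^ p) := by
    intro y
    refine le_trans (Real.rpow_le_rpow (norm_nonneg _) ?_ hp0.le)
      (rpow_add_three_le hR0 (norm_nonneg _) hR0 hp0)
    have h1 := hAF (y + (2 * m) • signVec (4 * m) S 1)
    have h2 := hAF y
    rw [norm_sub_rev] at h1
    have h3 := norm_add₃_le (a := F (y + (2 * m) • signVec (4 * m) S 1) -
      A (y + (2 * m) • signVec (4 * m) S 1)) (b := A (y + (2 * m) • signVec (4 * m) S 1) - A y)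
      (c := A y - F y)
    rw [sub_add_sub_cancel, sub_add_sub_cancel] at h3
    linarith
  refine (Finset.sum_le_sum fun y _ => hpt y).trans ?_
  rw [← Finset.mul_sum, Finset.sum_add_distrib, Finset.sum_add_distrib, Finset.sum_const,
    Finset.card_univ, nsmul_eq_mul, ← hg]
  calc _ ≤ 3 ^ p * (g * R ^ p + g * ((m : ℝ) ^ p * (2 ^ p * 2 * Φ)) + g * R ^ p) := by gcongr
    _ = _ := by ring

/-- The tent function `0, 1, …, 2m-1, 2m-1, …, 1, 0` on `ℤ/4m`. -/
def tent (m : ℕ) (a : ZMod (4 * m)) : ℕ := if a.val < 2 * m then a.val else 4 * m - 1 - a.val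

section Tent

variable {m : ℕ} [NeZero (4 * m)]

theorem tent_lt (a : ZMod (4 * m)) : tent m a < 2 * m := by
  have := ZMod.val_lt a
  have := NeZero.ne (4 * m)
  unfold tent; split_ifs <;> omega

theorem val_add_natCast (a : ZMod (4 * m)) {c : ℕ} (hc : c < 4 * m) :
    (a + (c : ZMod (4 * m))).val = a.val + c ∨ (a + (c : ZMod (4 * m))).val + 4 * m = a.val + c := by
  have h := ZMod.val_natCast_of_lt hc
  rcases lt_or_ge (a.val + c) (4 * m) with h1 | h1
  · left
    rw [ZMod.val_add_of_lt (by rwa [h]), h]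
  · right
    rw [← h, ZMod.val_add_val_of_le (by rwa [h])]
    rw [h]

theorem abs_tent_add_one_sub_le (a : ZMod (4 * m)) :
    |(tent m (a + 1) : ℤ) - tent m a| ≤ 1 := by
  have h0 := NeZero.ne (4 * m)
  have h := val_add_natCast a (c := 1) (by omega)
  have h1 := ZMod.val_lt a
  have h2 := ZMod.val_lt (a + ((1 : ℕ) : ZMod (4 * m)))
  rw [Nat.cast_one] at h h2
  unfold tent
  rw [abs_le]
  split_ifs <;> omega

theorem le_abs_tent_add_abs_tent (a : ZMod (4 * m)) :
    2 * (m : ℤ) ≤ |(tent m (a + (2 * m : ℕ)) : ℤ) - tent m a| +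
      |(tent m (a + (m : ℕ) + (2 * m : ℕ)) : ℤ) - tent m (a + (m : ℕ))| := by
  have h0 := NeZero.ne (4 * m)
  have h := val_add_natCast a (c := m) (by omega)
  have h' := val_add_natCast a (c := 2 * m) (by omega)
  have h'' := val_add_natCast (a + ((m : ℕ) : ZMod (4 * m))) (c := 2 * m) (by omega)
  have h1 := ZMod.val_lt a
  have h2 := ZMod.val_lt (a + ((m : ℕ) : ZMod (4 * m)))
  have h3 := ZMod.val_lt (a + ((2 * m : ℕ) : ZMod (4 * m)))
  have h4 := ZMod.val_lt (a + ((m : ℕ) : ZMod (4 * m)) + ((2 * m : ℕ) : ZMod (4 * m)))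
  unfold tent
  generalize (a + ((m : ℕ) : ZMod (4 * m)) + ((2 * m : ℕ) : ZMod (4 * m))).val = v3 at *
  generalize (a + ((m : ℕ) : ZMod (4 * m))).val = v1 at *
  generalize (a + ((2 * m : ℕ) : ZMod (4 * m))).val = v2 at *
  generalize a.val = v at *
  have e : ∀ x : ℤ, |x| = if 0 ≤ x then x else -x := fun x => by
    split_ifs with hx
    · exact abs_of_nonneg hx
    · exact abs_of_neg (by omega)
  simp only [e]
  split_ifs <;> omega

end Tent

section GridLower

variable {n m M : ℕ} [NeZero (4 * m)]

/-- Wrap the torus `(ℤ/4m)^n` onto the grid by the tent function in each coordinate. -/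
def tentMap (hM : 2 * m ≤ M) (y : Fin n → ZMod (4 * m)) : Fin n → Fin M :=
  fun i => ⟨tent m (y i), (tent_lt (y i)).trans_le hM⟩

theorem gridDist_tentMap (hM : 2 * m ≤ M) (q : ℝ) (y z : Fin n → ZMod (4 * m)) :
    gridDist q (tentMap hM y) (tentMap hM z) =
      (∑ i, |(((tent m (y i) : ℤ) - tent m (z i) : ℤ) : ℝ)| ^ q) ^ (1 / q) := by
  simp [gridDist, lqDist, tentMap]

theorem gridDist_tentMap_add_signVec_le (hM : 2 * m ≤ M) {q : ℝ} (hq : 0 < q)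
    (y : Fin n → ZMod (4 * m)) (S : Finset (Fin n)) (x : Fin n → ℤˣ) :
    gridDist q (tentMap hM (y + signVec (4 * m) S x)) (tentMap hM y) ≤ (n : ℝ) ^ (1 / q) := by
  rw [gridDist_tentMap]
  refine Real.rpow_le_rpow (Finset.sum_nonneg fun i _ => by positivity) ?_ (by positivity)
  have h : ∀ i, |(tent m ((y + signVec (4 * m) S x) i) : ℤ) - tent m (y i)| ≤ 1 := by
    intro i
    by_cases hi : i ∈ S
    · rcases Int.units_eq_one_or (x i) with hx | hx
      · simpa [signVec, hi, hx] using abs_tent_add_one_sub_le (y i)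
      · have := abs_tent_add_one_sub_le (y i + -1)
        rw [neg_add_cancel_right, abs_sub_comm] at this
        simpa [signVec, hi, hx] using this
    · simp [signVec, hi]
  calc _ ≤ ∑ _i : Fin n, (1 : ℝ) := by
        refine Finset.sum_le_sum fun i _ => Real.rpow_le_one (abs_nonneg _) ?_ hq.le
        exact_mod_cast h i
    _ = n := by simp

theorem gridDist_tentMap_add_single_two_le (hM : 2 * m ≤ M) {q : ℝ} (hq : 0 < q)
    (y : Fin n → ZMod (4 * m)) (j : Fin n) :
    gridDist q (tentMap hM (y + Pi.single j 2)) (tentMap hM y) ≤ 2 := by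
  rw [gridDist_tentMap, Finset.sum_eq_single j]
  · rw [← Real.rpow_mul (abs_nonneg _), mul_one_div_cancel hq.ne', Real.rpow_one]
    have h1 := abs_tent_add_one_sub_le (y j)
    have h2 := abs_tent_add_one_sub_le (y j + 1)
    rw [add_assoc, one_add_one_eq_two] at h2
    have h3 : |(tent m ((y + Pi.single j 2 : Fin n → ZMod (4 * m)) j) : ℤ) - tent m (y j)| ≤ 2 := by
      simp only [Pi.add_apply, Pi.single_eq_same]
      rw [abs_le] at *
      omega
    exact_mod_cast h3
  · intro i _ hi
    simp [hi, Real.zero_rpow hq.ne']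
  · simp

theorem le_gridDist_tentMap_rpow_add (hM : 2 * m ≤ M) {p q : ℝ} (hq : 0 < q) (hp : 0 < p)
    (y : Fin n → ZMod (4 * m)) (S : Finset (Fin n)) :
    ((S.card : ℝ) / 2) ^ (p / q) * (m : ℝ) ^ p ≤
      gridDist q (tentMap hM (y + (2 * m) • signVec (4 * m) S 1)) (tentMap hM y) ^ p +
      gridDist q (tentMap hM (y + (fun _ => ((m : ℕ) : ZMod (4 * m))) +
        (2 * m) • signVec (4 * m) S 1)) (tentMap hM (y + fun _ => ((m : ℕ) : ZMod (4 * m)))) ^ p := by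
  have key : ∀ z : Fin n → ZMod (4 * m), gridDist q (tentMap hM (z + (2 * m) • signVec (4 * m) S 1))
      (tentMap hM z) ^ p = (∑ i, |(((tent m ((z + (2 * m) • signVec (4 * m) S 1) i) : ℤ) -
        tent m (z i) : ℤ) : ℝ)| ^ q) ^ (p / q) := by
    intro z
    rw [gridDist_tentMap, ← Real.rpow_mul (Finset.sum_nonneg fun i _ => by positivity)]
    congr 1; ring
  have low : ∀ z : Fin n → ZMod (4 * m),
      ∑ i ∈ S, |(((tent m (z i + (2 * m : ℕ)) : ℤ) - tent m (z i) : ℤ) : ℝ)| ^ q ≤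
      ∑ i, |(((tent m ((z + (2 * m) • signVec (4 * m) S 1) i) : ℤ) -
        tent m (z i) : ℤ) : ℝ)| ^ q := by
    intro z
    calc _ = ∑ i ∈ S, |(((tent m ((z + (2 * m) • signVec (4 * m) S 1) i) : ℤ) -
          tent m (z i) : ℤ) : ℝ)| ^ q :=
          Finset.sum_congr rfl fun i hi => by simp [signVec, hi]
      _ ≤ _ := Finset.sum_le_sum_of_subset_of_nonneg (Finset.subset_univ _)
          fun i _ _ => by positivity
  rw [key, key]
  have l1 := low y
  have l2 := low (y + fun _ => ((m : ℕ) : ZMod (4 * m)))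
  generalize ∑ i, |(((tent m ((y + (2 * m) • signVec (4 * m) S 1) i) : ℤ) -
        tent m (y i) : ℤ) : ℝ)| ^ q = U at l1 ⊢
  generalize ∑ i, |(((tent m ((y + (fun _ => ((m : ℕ) : ZMod (4 * m))) +
    (2 * m) • signVec (4 * m) S 1 : Fin n → ZMod (4 * m)) i) : ℤ) -
        tent m ((y + fun _ => ((m : ℕ) : ZMod (4 * m)) : Fin n → ZMod (4 * m)) i) : ℤ) : ℝ)| ^ q = V at l2 ⊢
  have hU : 0 ≤ U := (Finset.sum_nonneg fun i _ => by positivity).trans l1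
  have hV : 0 ≤ V := (Finset.sum_nonneg fun i _ => by positivity).trans l2
  have hsum : (S.card : ℝ) * (m : ℝ) ^ q ≤ U + V := by
    refine le_trans ?_ (add_le_add l1 l2)
    rw [← Finset.sum_add_distrib, ← nsmul_eq_mul]
    refine Finset.card_nsmul_le_sum _ _ _ fun i _ => ?_
    have h := le_abs_tent_add_abs_tent (y i)
    simp only [Pi.add_apply]
    generalize (tent m (y i + (2 * m : ℕ)) : ℤ) - tent m (y i) = a at *
    generalize (tent m (y i + (m : ℕ) + (2 * m : ℕ)) : ℤ) - tent m (y i + (m : ℕ)) = b at *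
    have ha : 0 ≤ |(a : ℝ)| ^ q := by positivity
    have hb : 0 ≤ |(b : ℝ)| ^ q := by positivity
    rcases le_total (m : ℤ) |a| with hma | hma
    · have : (m : ℝ) ≤ |(a : ℝ)| := by exact_mod_cast hma
      have := Real.rpow_le_rpow (by positivity) this hq.le
      linarith
    · have : (m : ℤ) ≤ |b| := by omega
      have : (m : ℝ) ≤ |(b : ℝ)| := by exact_mod_cast this
      have := Real.rpow_le_rpow (by positivity) this hq.le
      linarith
  have e : ((S.card : ℝ) / 2) ^ (p / q) * (m : ℝ) ^ p =
      ((S.card : ℝ) * (m : ℝ) ^ q / 2) ^ (p / q) := by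
    rw [mul_div_right_comm, Real.mul_rpow (by positivity) (by positivity), ← Real.rpow_mul
      (by positivity), mul_div_cancel₀ _ hq.ne']
  rw [e]
  have hU' : 0 ≤ U ^ (p / q) := by positivity
  have hV' : 0 ≤ V ^ (p / q) := by positivity
  have hpq : 0 ≤ p / q := by positivity
  rcases le_total ((S.card : ℝ) * (m : ℝ) ^ q / 2) U with h | h
  · have := Real.rpow_le_rpow (by positivity) h hpq
    linarith
  · have := Real.rpow_le_rpow (by positivity)
      (by linarith : (S.card : ℝ) * (m : ℝ) ^ q / 2 ≤ V) hpq
    linarith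

/-- The constraint that the `X_p` inequality puts on an embedding of a grid into `L_p`. -/
theorem grid_embedding_constraint {k : ℕ} {p q D : ℝ} (hp : 2 ≤ p) (hq : 0 < q) (hD0 : 0 ≤ D)
    (hM : 2 * m ≤ M) (f : (Fin n → Fin M) → LpSpace p)
    (hf : ∀ x y, gridDist q x y ≤ ‖f x - f y‖ ∧ ‖f x - f y‖ ≤ D * gridDist q x y)
    (hk : 0 < k) (hkn : 2 * k ≤ n) :
    ((k : ℝ) / 2) ^ (p / q) * (m : ℝ) ^ p ≤ 2 * (3 ^ p * (2 * (D * (n : ℝ) ^ (1 / q)) ^ p +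
      (m : ℝ) ^ p * (2 ^ p * 2 * (3 * ((p * (p - 1) * 2 ^ p * k / (n / 2)) ^ (p / 2) *
        (2 * (D * (n : ℝ) ^ (1 / q))) ^ p + k * (2 ^ p * D ^ p)))))) := by
  have hp0 : 0 < p := by linarith
  have : Fact (1 ≤ ENNReal.ofReal p) := ⟨by simp; linarith⟩
  obtain ⟨S, hSc, hS⟩ := exists_finset_sum_norm_shift_le hp (fun y => f (tentMap hM y))
    (R := D * (n : ℝ) ^ (1 / q)) (D := D) (by positivity) hD0
    (fun y S x => (hf _ _).2.trans
      (mul_le_mul_of_nonneg_left (gridDist_tentMap_add_signVec_le hM hq y S x) hD0))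
    (fun y j => (hf _ _).2.trans (by
      rw [mul_comm 2 D]
      exact mul_le_mul_of_nonneg_left (gridDist_tentMap_add_single_two_le hM hq y j) hD0)) hk hkn
  set B : ℝ := 3 ^ p * (2 * (D * (n : ℝ) ^ (1 / q)) ^ p +
      (m : ℝ) ^ p * (2 ^ p * 2 * (3 * ((p * (p - 1) * 2 ^ p * k / (n / 2)) ^ (p / 2) *
        (2 * (D * (n : ℝ) ^ (1 / q))) ^ p + k * (2 ^ p * D ^ p))))) with hB
  let b : (Fin n → ZMod (4 * m)) → ℝ := fun y =>
    ‖f (tentMap hM (y + (2 * m) • signVec (4 * m) S 1)) - f (tentMap hM y)‖ ^ p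
  have hb : ∑ y, b (y + fun _ => ((m : ℕ) : ZMod (4 * m))) = ∑ y, b y :=
    Equiv.sum_comp (Equiv.addRight _) b
  have hg : (0 : ℝ) < Fintype.card (Fin n → ZMod (4 * m)) := by exact_mod_cast Fintype.card_pos
  have hdist : ∀ z w : Fin n → Fin M, 0 ≤ gridDist q z w := fun z w =>
    Real.rpow_nonneg (Finset.sum_nonneg fun i _ => by positivity) _
  have hlow : ∀ y, ((k : ℝ) / 2) ^ (p / q) * (m : ℝ) ^ p ≤
      b y + b (y + fun _ => ((m : ℕ) : ZMod (4 * m))) := by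
    intro y
    have h := le_gridDist_tentMap_rpow_add hM hq hp0 y S
    rw [hSc] at h
    exact h.trans (add_le_add (Real.rpow_le_rpow (hdist _ _) (hf _ _).1 hp0.le)
      (Real.rpow_le_rpow (hdist _ _) (hf _ _).1 hp0.le))
  have h := Finset.sum_le_sum fun y (_ : y ∈ univ) => hlow y
  rw [Finset.sum_const, Finset.card_univ, nsmul_eq_mul, Finset.sum_add_distrib, hb] at h
  refine le_of_mul_le_mul_left (h.trans ?_) hg
  have h' : ∑ y, b y ≤ Fintype.card (Fin n → ZMod (4 * m)) * B := hS
  linarith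

end GridLower

theorem exists_le_distortion_of_grid_embedding {p q α β γ c₀ : ℝ} (hp : 2 ≤ p) (hq : 0 < q)
    (hβ0 : 0 ≤ β) (hβ : β = 1 - 2 * α) (hα : p / q = β + α * p) (hγ : γ * p + β = β * (p / q))
    (hc₀ : 0 < c₀) :
    ∃ c : ℝ, 0 < c ∧ ∀ (n M : ℕ) (D : ℝ) (f : (Fin n → Fin M) → LpSpace p), 0 < n → 2 ≤ M →
      4 ≤ (n : ℝ) ^ (2 * α) → c₀ * (n : ℝ) ^ α ≤ M → 0 ≤ D →
      (∀ x y, gridDist q x y ≤ ‖f x - f y‖ ∧ ‖f x - f y‖ ≤ D * gridDist q x y) →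
      c * (n : ℝ) ^ γ ≤ D := by
  have hp0 : 0 < p := by linarith
  set K : ℝ := p * (p - 1) * 2 ^ p * 4 with hK
  have hK0 : 0 ≤ K := by
    have : 0 ≤ p - 1 := by linarith
    positivity
  set C : ℝ := 2 * 3 ^ p * (2 * (3 / c₀) ^ p + 2 ^ p * 6 * (K ^ (p / 2) * 2 ^ p + 2 * 2 ^ p))
    with hC
  have hC0 : 0 < C := by positivity
  refine ⟨((2 ^ (p / q) * C) ^ (1 / p))⁻¹, by positivity, ?_⟩
  intro n M D f hn hM hn4 hMn hD hf
  have hx0 : (0 : ℝ) < n := by exact_mod_cast hn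
  have hx1 : (1 : ℝ) ≤ n := by exact_mod_cast hn
  generalize hx : (n : ℝ) = x at *
  set a : ℝ := x ^ α with ha
  set B : ℝ := x ^ β with hB
  have ha0 : 0 < a := by positivity
  have hB0 : 0 < B := by positivity
  have hB1 : 1 ≤ B := Real.one_le_rpow hx1 hβ0
  have ha2 : x ^ (2 * α) = a ^ 2 := by
    rw [ha, ← Real.rpow_natCast, ← Real.rpow_mul hx0.le]; congr 1; push_cast; ring
  have hxB : x = B * a ^ 2 := by
    rw [← ha2, hB, ← Real.rpow_add hx0, hβ]; simp
  have hxq : x ^ (p / q) = B * a ^ p := by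
    rw [hα, Real.rpow_add hx0, Real.rpow_mul hx0.le]
  have hBg : B ^ (p / q) = (x ^ γ) ^ p * B := by
    rw [hB, ← Real.rpow_mul hx0.le, ← hγ, Real.rpow_add hx0, Real.rpow_mul hx0.le]
  obtain ⟨k, hkdef⟩ : ∃ k, k = ⌈B⌉₊ := ⟨_, rfl⟩
  have hkB : B ≤ k := hkdef ▸ Nat.le_ceil B
  have hk2 : (k : ℝ) ≤ 2 * B := by
    have := Nat.ceil_lt_add_one hB0.le
    rw [← hkdef] at this
    linarith
  have hk0 : 0 < k := by
    have : (0 : ℝ) < k := by linarith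
    exact_mod_cast this
  have hkn : 2 * k ≤ n := by
    have : (2 : ℝ) * k ≤ n := by
      rw [hx, hxB]; rw [ha2] at hn4; nlinarith
    exact_mod_cast this
  obtain ⟨m, hm⟩ : ∃ m, m = M / 2 := ⟨_, rfl⟩
  have hm2 : 2 * m ≤ M := by omega
  have hm3 : M ≤ 3 * m := by omega
  have hm0 : 0 < m := by omega
  have hm3' : (M : ℝ) ≤ 3 * m := by exact_mod_cast hm3
  have hmr : (0 : ℝ) < m := by exact_mod_cast hm0
  have : NeZero (4 * m) := ⟨by omega⟩
  have key := grid_embedding_constraint hp hq hD hm2 f hf hk0 hkn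
  rw [hx] at key
  have e1 : (D * x ^ (1 / q)) ^ p = D ^ p * (B * a ^ p) := by
    rw [Real.mul_rpow hD (by positivity), ← Real.rpow_mul hx0.le, ← hxq]; congr 2; ring
  have e2 : (2 * (D * x ^ (1 / q))) ^ p = 2 ^ p * (D ^ p * (B * a ^ p)) := by
    rw [Real.mul_rpow (by norm_num) (by positivity), e1]
  have e3 : (p * (p - 1) * 2 ^ p * k / (x / 2)) ^ (p / 2) ≤ K ^ (p / 2) * (a ^ p)⁻¹ := by
    have h1 : p * (p - 1) * 2 ^ p * k / (x / 2) ≤ K * (a ^ 2)⁻¹ := by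
      have h2 : 0 ≤ p * (p - 1) * 2 ^ p := by
        have : 0 ≤ p - 1 := by linarith
        positivity
      calc p * (p - 1) * 2 ^ p * k / (x / 2) ≤ p * (p - 1) * 2 ^ p * (2 * B) / (x / 2) := by
            gcongr
        _ = K * (a ^ 2)⁻¹ := by rw [hK, hxB]; field_simp; norm_num
    have h2 : 0 ≤ p * (p - 1) * 2 ^ p * k / (x / 2) := by
      have : 0 ≤ p - 1 := by linarith
      positivity
    refine (Real.rpow_le_rpow h2 h1 (by positivity)).trans (le_of_eq ?_)
    rw [Real.mul_rpow hK0 (by positivity), Real.inv_rpow (by positivity), ← Real.rpow_natCast,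
      ← Real.rpow_mul ha0.le]
    congr 3; push_cast; ring
  have e4 : a ^ p ≤ (m : ℝ) ^ p * (3 / c₀) ^ p := by
    rw [← Real.mul_rpow hmr.le (by positivity)]
    refine Real.rpow_le_rpow ha0.le ?_ hp0.le
    rw [mul_div_assoc', le_div_iff₀ hc₀]
    linarith
  have hap : 0 < a ^ p := by positivity
  have hDp : 0 ≤ D ^ p := by positivity
  have hmp : 0 < (m : ℝ) ^ p := by positivity
  have upper : ((k : ℝ) / 2) ^ (p / q) * (m : ℝ) ^ p ≤ (m : ℝ) ^ p * (D ^ p * B * C) := by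
    refine key.trans ?_
    rw [e1, e2]
    calc _ ≤ 2 * (3 ^ p * (2 * (D ^ p * (B * ((m : ℝ) ^ p * (3 / c₀) ^ p))) +
          (m : ℝ) ^ p * (2 ^ p * 2 * (3 * (K ^ (p / 2) * (a ^ p)⁻¹ *
          (2 ^ p * (D ^ p * (B * a ^ p))) + (2 * B) * (2 ^ p * D ^ p)))))) := by gcongr
      _ = _ := by rw [hC]; field_simp; ring
  have lower : 2⁻¹ ^ (p / q) * ((x ^ γ) ^ p * B) ≤ ((k : ℝ) / 2) ^ (p / q) := by
    rw [← hBg, ← Real.mul_rpow (by norm_num) hB0.le]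
    exact Real.rpow_le_rpow (by positivity) (by linarith) (by positivity)
  have h1 : (x ^ γ) ^ p ≤ (2 ^ (p / q) * C) * D ^ p := by
    rw [mul_comm] at upper
    have h2 := lower.trans (le_of_mul_le_mul_left upper hmp)
    rw [Real.inv_rpow (by norm_num), inv_mul_le_iff₀ (by positivity)] at h2
    refine le_of_mul_le_mul_right (h2.trans (le_of_eq ?_)) hB0
    ring
  rw [inv_mul_le_iff₀ (by positivity), ← Real.rpow_le_rpow_iff (by positivity) (by positivity) hp0,
    Real.mul_rpow (by positivity) hD,
    ← Real.rpow_mul (x := 2 ^ (p / q) * C) (by positivity), one_div_mul_cancel hp0.ne',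
    Real.rpow_one]
  exact h1

section Khinchine

variable {ι : Type*} [Fintype ι] [DecidableEq ι]

theorem sum_exp_sign_linear (b : ι → ℝ) :
    (Fintype.card (ι → ℤˣ) : ℝ)⁻¹ * ∑ η : ι → ℤˣ, Real.exp (∑ j, b j * ((η j : ℤ) : ℝ)) =
      ∏ j, Real.cosh (b j) := by
  have h1 : ∑ η : ι → ℤˣ, Real.exp (∑ j, b j * ((η j : ℤ) : ℝ)) =
      ∏ j, ∑ e : ℤˣ, Real.exp (b j * ((e : ℤ) : ℝ)) := by
    rw [Finset.prod_univ_sum, Fintype.piFinset_univ]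
    exact Finset.sum_congr rfl fun η _ => Real.exp_sum _ _
  have h2 : ∀ j, ∑ e : ℤˣ, Real.exp (b j * ((e : ℤ) : ℝ)) = 2 * Real.cosh (b j) := by
    intro j
    have : (Finset.univ : Finset ℤˣ) = {1, -1} := rfl
    rw [this, Finset.sum_pair (by decide), Real.cosh_eq]
    simp
    ring
  rw [h1, Finset.prod_congr rfl fun j _ => h2 j, Finset.prod_mul_distrib]
  simp

theorem avg_exp_sign_linear_le (b : ι → ℝ) :
    (Fintype.card (ι → ℤˣ) : ℝ)⁻¹ * ∑ η : ι → ℤˣ, Real.exp (∑ j, b j * ((η j : ℤ) : ℝ)) ≤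
      Real.exp ((∑ j, b j ^ 2) / 2) := by
  rw [sum_exp_sign_linear, Finset.sum_div, Real.exp_sum]
  exact Finset.prod_le_prod (fun _ _ => (Real.cosh_pos _).le) fun j _ => Real.cosh_le_exp_half_sq _

theorem abs_rpow_le_exp {r : ℝ} (hr : 0 < r) (t : ℝ) :
    |t| ^ r ≤ r ^ r * (Real.exp t + Real.exp (-t)) := by
  have h1 : |t| / r ≤ Real.exp (|t| / r) := by linarith [Real.add_one_le_exp (|t| / r)]
  have h2 := Real.rpow_le_rpow (by positivity) h1 hr.le
  rw [← Real.exp_mul, div_mul_cancel₀ _ hr.ne', Real.div_rpow (abs_nonneg _) hr.le,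
    div_le_iff₀ (by positivity)] at h2
  have h3 : Real.exp |t| ≤ Real.exp t + Real.exp (-t) := by
    rcases abs_choice t with h | h <;> rw [h]
    · linarith [Real.exp_pos (-t)]
    · linarith [Real.exp_pos t]
  have : 0 < r ^ r := by positivity
  nlinarith

/-- The upper bound in Khinchine's inequality. -/
theorem avg_abs_sign_linear_rpow_le {r : ℝ} (hr : 0 < r) (a : ι → ℝ) :
    (Fintype.card (ι → ℤˣ) : ℝ)⁻¹ * ∑ η : ι → ℤˣ, |∑ j, a j * ((η j : ℤ) : ℝ)| ^ r ≤
      r ^ r * (2 * Real.exp (1 / 2)) * (∑ j, a j ^ 2) ^ (r / 2) := by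
  have hs : 0 ≤ ∑ j, a j ^ 2 := Finset.sum_nonneg fun _ _ => sq_nonneg _
  rcases hs.eq_or_lt with h0 | hpos
  · have : ∀ j, a j = 0 := by
      intro j
      have := (Finset.sum_eq_zero_iff_of_nonneg fun i _ => sq_nonneg (a i)).1 h0.symm j
        (Finset.mem_univ j)
      exact pow_eq_zero_iff two_ne_zero |>.1 this
    simp [this, Real.zero_rpow hr.ne', Real.zero_rpow (half_pos hr).ne']
  · set σ := √(∑ j, a j ^ 2) with hσ
    have hσ0 : 0 < σ := Real.sqrt_pos.2 hpos
    have hσ2 : σ ^ 2 = ∑ j, a j ^ 2 := Real.sq_sqrt hs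
    have hσr : (∑ j, a j ^ 2) ^ (r / 2) = σ ^ r := by
      rw [← hσ2, ← Real.rpow_natCast, ← Real.rpow_mul hσ0.le]; congr 1; push_cast; ring
    have hb : ∑ j, (a j / σ) ^ 2 = 1 := by
      simp only [div_pow]
      rw [← Finset.sum_div, hσ2, div_self hpos.ne']
    have e1 := avg_exp_sign_linear_le (fun j => a j / σ)
    have e2 := avg_exp_sign_linear_le (fun j => -(a j / σ))
    simp only [neg_sq, hb, neg_mul, Finset.sum_neg_distrib] at e1 e2
    have hpt : ∀ η : ι → ℤˣ, |∑ j, a j * ((η j : ℤ) : ℝ)| ^ r ≤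
        σ ^ r * (r ^ r * (Real.exp (∑ j, a j / σ * ((η j : ℤ) : ℝ)) +
          Real.exp (-∑ j, a j / σ * ((η j : ℤ) : ℝ)))) := by
      intro η
      have : ∑ j, a j * ((η j : ℤ) : ℝ) = σ * ∑ j, a j / σ * ((η j : ℤ) : ℝ) := by
        rw [Finset.mul_sum]
        exact Finset.sum_congr rfl fun j _ => by field_simp
      rw [this, abs_mul, abs_of_pos hσ0, Real.mul_rpow hσ0.le (abs_nonneg _)]
      gcongr
      exact abs_rpow_le_exp hr _
    rw [hσr]
    calc _ ≤ (Fintype.card (ι → ℤˣ) : ℝ)⁻¹ * ∑ η : ι → ℤˣ,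
          σ ^ r * (r ^ r * (Real.exp (∑ j, a j / σ * ((η j : ℤ) : ℝ)) +
          Real.exp (-∑ j, a j / σ * ((η j : ℤ) : ℝ)))) := by
          gcongr with η _
          exact hpt η
      _ = σ ^ r * r ^ r * ((Fintype.card (ι → ℤˣ) : ℝ)⁻¹ *
            ∑ η : ι → ℤˣ, Real.exp (∑ j, a j / σ * ((η j : ℤ) : ℝ)) +
          (Fintype.card (ι → ℤˣ) : ℝ)⁻¹ *
            ∑ η : ι → ℤˣ, Real.exp (-∑ j, a j / σ * ((η j : ℤ) : ℝ))) := by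
          rw [← Finset.mul_sum, ← Finset.mul_sum, Finset.sum_add_distrib]; ring
      _ ≤ σ ^ r * r ^ r * (Real.exp (1 / 2) + Real.exp (1 / 2)) := by gcongr
      _ = _ := by ring

theorem le_avg_abs_sign_linear_rpow {r : ℝ} (hr : 2 ≤ r) (a : ι → ℝ) :
    (∑ j, a j ^ 2) ^ (r / 2) ≤
      (Fintype.card (ι → ℤˣ) : ℝ)⁻¹ * ∑ η : ι → ℤˣ, |∑ j, a j * ((η j : ℤ) : ℝ)| ^ r := by
  have h := abs_card_inv_mul_sum_rpow_le
    (fun η : ι → ℤˣ => (∑ j, a j * ((η j : ℤ) : ℝ)) ^ 2) (s := r / 2) (by linarith)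
  rw [sum_sign_linear_sq, inv_mul_cancel_left₀ (by exact_mod_cast Fintype.card_ne_zero),
    abs_of_nonneg (Finset.sum_nonneg fun _ _ => sq_nonneg _)] at h
  refine h.trans (le_of_eq ?_)
  congr 1
  refine Finset.sum_congr rfl fun η _ => ?_
  rw [abs_of_nonneg (sq_nonneg _), ← sq_abs, ← Real.rpow_natCast, ← Real.rpow_mul (abs_nonneg _)]
  congr 1; push_cast; ring

end Khinchine

section Interpolation

variable {ι : Type*} [Fintype ι]

theorem sum_abs_rpow_le_of_le {p q : ℝ} (hq : 0 < q) (hqp : q ≤ p) (z : ι → ℝ) :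
    ∑ i, |z i| ^ p ≤ (∑ i, |z i| ^ q) ^ (p / q) := by
  have hnn : ∀ i ∈ Finset.univ, 0 ≤ |z i| ^ q := fun i _ => by positivity
  have hs : 0 ≤ ∑ i, |z i| ^ q := Finset.sum_nonneg hnn
  have hpq : 0 ≤ p / q - 1 := by rw [sub_nonneg, le_div_iff₀ hq]; linarith
  have h : ∀ i, |z i| ^ p ≤ (∑ i, |z i| ^ q) ^ (p / q - 1) * |z i| ^ q := by
    intro i
    have hle : |z i| ^ q ≤ ∑ i, |z i| ^ q := Finset.single_le_sum hnn (Finset.mem_univ i)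
    calc |z i| ^ p = (|z i| ^ q) ^ (p / q - 1) * |z i| ^ q := by
          rw [← Real.rpow_mul (abs_nonneg _), ← Real.rpow_add_of_nonneg (abs_nonneg _)
            (by positivity) hq.le]
          congr 1; field_simp; ring
      _ ≤ _ := by gcongr
  refine (Finset.sum_le_sum fun i _ => h i).trans (le_of_eq ?_)
  rw [← Finset.mul_sum]
  nth_rw 2 [← Real.rpow_one (∑ i, |z i| ^ q)]
  rw [← Real.rpow_add_of_nonneg hs hpq (by norm_num)]
  congr 1; ring

theorem sum_sq_rpow_le_card_mul {q : ℝ} (hq : 2 ≤ q) (z : ι → ℝ) :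
    (∑ i, z i ^ 2) ^ (q / 2) ≤ (Fintype.card ι : ℝ) ^ (q / 2 - 1) * ∑ i, |z i| ^ q := by
  have h := Real.rpow_sum_le_const_mul_sum_rpow Finset.univ (fun i => z i ^ 2) (p := q / 2)
    (by linarith)
  simp only [abs_sq, Finset.card_univ] at h
  refine h.trans (le_of_eq ?_)
  congr 1
  refine Finset.sum_congr rfl fun i _ => ?_
  rw [← sq_abs, ← Real.rpow_natCast, ← Real.rpow_mul (abs_nonneg _)]
  congr 1; push_cast; ring

theorem sum_abs_rpow_le_interpolate {p q θ : ℝ} (hθ0 : 0 < θ) (hθ1 : θ < 1) (hp : 0 < p)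
    (h : q = 2 * θ + p * (1 - θ)) (z : ι → ℝ) :
    ∑ i, |z i| ^ q ≤ (∑ i, z i ^ 2) ^ θ * (∑ i, |z i| ^ p) ^ (1 - θ) := by
  have h1θ : 0 < 1 - θ := by linarith
  have hc : (1 / θ).HolderConjugate (1 / (1 - θ)) := by
    rw [Real.holderConjugate_iff]
    refine ⟨by rw [lt_div_iff₀ hθ0]; linarith, by simp⟩
  have hh := Real.inner_le_Lp_mul_Lq_of_nonneg Finset.univ hc (f := fun i => (z i ^ 2) ^ θ)
    (g := fun i => (|z i| ^ p) ^ (1 - θ)) (fun i _ => by positivity) (fun i _ => by positivity)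
  simp only [one_div_one_div] at hh
  have e1 : ∀ i, ((z i ^ 2) ^ θ) ^ (1 / θ) = z i ^ 2 := fun i => by
    rw [← Real.rpow_mul (sq_nonneg _), mul_one_div_cancel hθ0.ne', Real.rpow_one]
  have e2 : ∀ i, ((|z i| ^ p) ^ (1 - θ)) ^ (1 / (1 - θ)) = |z i| ^ p := fun i => by
    rw [← Real.rpow_mul (by positivity), mul_one_div_cancel h1θ.ne', Real.rpow_one]
  simp only [e1, e2] at hh
  refine le_trans (le_of_eq ?_) hh
  refine Finset.sum_congr rfl fun i _ => ?_
  rw [← sq_abs, ← Real.rpow_natCast, ← Real.rpow_mul (abs_nonneg _), ← Real.rpow_mul (abs_nonneg _),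
    ← Real.rpow_add_of_nonneg (abs_nonneg _) (by positivity) (by positivity), h]
  norm_num

end Interpolation

theorem lqDist_nonneg {n : ℕ} (q : ℝ) (x y : Fin n → ℝ) : 0 ≤ lqDist q x y :=
  Real.rpow_nonneg (Finset.sum_nonneg fun _ _ => by positivity) _

theorem lqDist_rpow {n : ℕ} (q r : ℝ) (x y : Fin n → ℝ) :
    lqDist q x y ^ r = (∑ i, |x i - y i| ^ q) ^ (r / q) := by
  rw [lqDist, ← Real.rpow_mul (Finset.sum_nonneg fun _ _ => by positivity)]
  congr 1; ring

/-- The embedding of `ℓ_q^n` into `ℓ_p` by coordinates and Rademacher sums. -/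
theorem exists_embedding_lq {p q γ : ℝ} (hq : 2 < q) (hqp : q < p)
    (hγ : γ = (q - 2) * (p - q) / (q ^ 2 * (p - 2))) :
    ∃ C : ℝ, 0 < C ∧ ∀ n : ℕ, 0 < n → ∃ f : (Fin n → ℝ) → LpSpace p, ∀ x y,
      lqDist q x y ≤ ‖f x - f y‖ ∧ ‖f x - f y‖ ≤ C * (n : ℝ) ^ γ * lqDist q x y := by
  have hq0 : 0 < q := by linarith
  have hp0 : 0 < p := by linarith
  have hp2 : 0 < p - 2 := by linarith
  set K : ℝ := p ^ p * (2 * Real.exp (1 / 2)) with hK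
  have hK0 : 0 < K := by positivity
  refine ⟨(1 + K) ^ (1 / p), by positivity, fun n hn => ?_⟩
  have hx0 : (0 : ℝ) < n := by exact_mod_cast hn
  set s : ℝ := (1 / 2 - 1 / q) * p with hs
  set N : ℝ := (Fintype.card (Fin n → ℤˣ) : ℝ) with hN
  have hN0 : 0 < N := by rw [hN]; exact_mod_cast Fintype.card_pos
  let g : (Fin n → ℝ) → Fin n ⊕ (Fin n → ℤˣ) → ℝ := fun a =>
    Sum.elim a fun ε => (N⁻¹ * (n : ℝ) ^ (-s)) ^ (1 / p) * ∑ i, a i * ((ε i : ℤ) : ℝ)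
  have hg : ∀ x y, ∑ i, |g x i - g y i| ^ p = ∑ i, |x i - y i| ^ p +
      (n : ℝ) ^ (-s) * (N⁻¹ * ∑ ε : Fin n → ℤˣ, |∑ i, (x i - y i) * ((ε i : ℤ) : ℝ)| ^ p) := by
    intro x y
    rw [Fintype.sum_sum_type]
    congr 1
    rw [Finset.mul_sum, Finset.mul_sum]
    refine Finset.sum_congr rfl fun ε _ => ?_
    simp only [g, Sum.elim_inr]
    rw [← mul_sub, abs_mul, Real.mul_rpow (abs_nonneg _) (abs_nonneg _),
      abs_of_nonneg (by positivity), ← Real.rpow_mul (by positivity), one_div_mul_cancel hp0.ne',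
      Real.rpow_one, ← Finset.sum_sub_distrib]
    simp only [sub_mul]
    ring
  have hb : ∀ z : Fin n → ℝ, (n : ℝ) ^ (-s) * (∑ i, z i ^ 2) ^ (p / 2) ≤
      (∑ i, |z i| ^ q) ^ (p / q) ∧ (n : ℝ) ^ (-(γ * p)) * (∑ i, |z i| ^ q) ^ (p / q) ≤
        ∑ i, |z i| ^ p + (n : ℝ) ^ (-s) * (∑ i, z i ^ 2) ^ (p / 2) := by
    intro z
    have hP := sum_abs_rpow_le_of_le hq0 hqp.le z
    have hS := sum_sq_rpow_le_card_mul hq.le z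
    have hQ := sum_abs_rpow_le_interpolate (p := p) (q := q) (θ := (p - q) / (p - 2))
      (div_pos (by linarith) hp2) (by rw [div_lt_one hp2]; linarith) hp0 (by field_simp; ring) z
    rw [Fintype.card_fin] at hS
    have hS0 : 0 ≤ ∑ i, z i ^ 2 := Finset.sum_nonneg fun _ _ => sq_nonneg _
    have hP0 : 0 ≤ ∑ i, |z i| ^ p := Finset.sum_nonneg fun _ _ => by positivity
    have hQ0 : 0 ≤ ∑ i, |z i| ^ q := Finset.sum_nonneg fun _ _ => by positivity
    generalize ∑ i, z i ^ 2 = S at *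
    generalize ∑ i, |z i| ^ p = P at *
    generalize ∑ i, |z i| ^ q = Q at *
    set θ := (p - q) / (p - 2) with hθ
    have hθ0 : 0 < θ := div_pos (by linarith) hp2
    have h1θ : 0 < 1 - θ := by rw [sub_pos, hθ, div_lt_one hp2]; linarith
    have hSp : (n : ℝ) ^ (-s) * S ^ (p / 2) ≤ Q ^ (p / q) := by
      have h := Real.rpow_le_rpow (by positivity) hS (by positivity : 0 ≤ p / q)
      rw [Real.mul_rpow (by positivity) hQ0, ← Real.rpow_mul hS0, ← Real.rpow_mul hx0.le] at h
      have e1 : q / 2 * (p / q) = p / 2 := by field_simp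
      have e2 : (q / 2 - 1) * (p / q) = s := by rw [hs]; field_simp
      rw [e1, e2] at h
      rw [Real.rpow_neg hx0.le, inv_mul_le_iff₀ (by positivity)]
      exact h
    refine ⟨hSp, ?_⟩
    set T := P + (n : ℝ) ^ (-s) * S ^ (p / 2) with hT
    have hT1 : 0 ≤ (n : ℝ) ^ (-s) * S ^ (p / 2) := by positivity
    have hT0 : 0 ≤ T := by linarith
    have hST : S ^ (p / 2) ≤ (n : ℝ) ^ s * T := by
      have : (n : ℝ) ^ (-s) * S ^ (p / 2) ≤ T := by linarith
      rwa [Real.rpow_neg hx0.le, inv_mul_le_iff₀ (by positivity)] at this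
    have hS2 : S ≤ ((n : ℝ) ^ s * T) ^ (2 / p) := by
      have h := Real.rpow_le_rpow (by positivity) hST (by positivity : 0 ≤ 2 / p)
      rwa [← Real.rpow_mul hS0, div_mul_div_cancel₀ (by norm_num : (2:ℝ) ≠ 0), div_self hp0.ne',
        Real.rpow_one] at h
    have hQT : Q ≤ ((n : ℝ) ^ s * T) ^ (2 / p * θ) * T ^ (1 - θ) := by
      refine hQ.trans ?_
      rw [Real.rpow_mul (by positivity)]
      gcongr
      linarith
    have h := Real.rpow_le_rpow hQ0 hQT (by positivity : 0 ≤ p / q)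
    rw [Real.mul_rpow (by positivity) (by positivity), Real.mul_rpow (by positivity) hT0,
      Real.mul_rpow (by positivity) (by positivity), ← Real.rpow_mul hx0.le,
      ← Real.rpow_mul hx0.le, ← Real.rpow_mul hT0, ← Real.rpow_mul hT0, mul_assoc,
      ← Real.rpow_add_of_nonneg hT0 (by positivity) (by positivity)] at h
    have e1 : s * (2 / p * θ) * (p / q) = γ * p := by
      rw [hs, hγ, hθ]; field_simp
    have e2 : 2 / p * θ * (p / q) + (1 - θ) * (p / q) = 1 := by
      rw [hθ]; field_simp; ring
    rw [e1, e2, Real.rpow_one] at h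
    rw [Real.rpow_neg hx0.le, inv_mul_le_iff₀ (by positivity)]
    exact h
  obtain ⟨f, hf⟩ := exists_embedding_of_finite (p := p) (by linarith) (d := lqDist q)
    (lqDist_nonneg q) g (A := (n : ℝ) ^ (-γ)) (B := (1 + K) ^ (1 / p)) (by positivity)
    (by positivity)
    (fun x y => by
      rw [Real.mul_rpow (by positivity) (lqDist_nonneg q x y), ← Real.rpow_mul hx0.le, neg_mul,
        lqDist_rpow, hg]
      refine (hb (fun i => x i - y i)).2.trans ?_
      gcongr
      exact le_avg_abs_sign_linear_rpow (by linarith) (fun i => x i - y i))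
    (fun x y => by
      rw [Real.mul_rpow (by positivity) (lqDist_nonneg q x y), ← Real.rpow_mul (by positivity),
        one_div_mul_cancel hp0.ne', Real.rpow_one, lqDist_rpow, hg, add_mul, one_mul]
      refine add_le_add (sum_abs_rpow_le_of_le hq0 hqp.le fun i => x i - y i) ?_
      have h1 := avg_abs_sign_linear_rpow_le hp0 (fun i => x i - y i)
      have h2 := (hb (fun i => x i - y i)).1
      calc _ ≤ (n : ℝ) ^ (-s) * (K * (∑ i, (x i - y i) ^ 2) ^ (p / 2)) := by gcongr
        _ = K * ((n : ℝ) ^ (-s) * (∑ i, (x i - y i) ^ 2) ^ (p / 2)) := by ring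
        _ ≤ _ := by gcongr)
  refine ⟨f, fun x y => ?_⟩
  have h := hf x y
  rwa [Real.rpow_neg hx0.le, div_inv_eq_mul] at h

theorem abs_cos_sub_cos_rpow_add_le {p : ℝ} (hp : 0 < p) (a b : ℝ) :
    |Real.cos a - Real.cos b| ^ p + |Real.sin a - Real.sin b| ^ p ≤ 2 * min |a - b| 2 ^ p := by
  have h1 : |Real.cos a - Real.cos b| ≤ min |a - b| 2 := by
    refine le_min (Real.abs_cos_sub_cos_le a b) ?_
    rw [abs_le]
    constructor <;> linarith [Real.cos_le_one a, Real.cos_le_one b, Real.neg_one_le_cos a,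
      Real.neg_one_le_cos b]
  have h2 : |Real.sin a - Real.sin b| ≤ min |a - b| 2 := by
    refine le_min (Real.abs_sin_sub_sin_le a b) ?_
    rw [abs_le]
    constructor <;> linarith [Real.sin_le_one a, Real.sin_le_one b, Real.neg_one_le_sin a,
      Real.neg_one_le_sin b]
  have h3 := Real.rpow_le_rpow (abs_nonneg _) h1 hp.le
  have h4 := Real.rpow_le_rpow (abs_nonneg _) h2 hp.le
  linarith

theorem le_abs_cos_sub_cos_rpow_add {p : ℝ} (hp : 0 < p) {a b : ℝ} (h1 : 1 ≤ |a - b|)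
    (h2 : |a - b| ≤ 2) :
    (1 / 8) ^ (p / 2) ≤ |Real.cos a - Real.cos b| ^ p + |Real.sin a - Real.sin b| ^ p := by
  have e : (Real.cos a - Real.cos b) ^ 2 + (Real.sin a - Real.sin b) ^ 2 =
      2 - 2 * Real.cos (a - b) := by
    rw [Real.cos_sub]
    linear_combination Real.sin_sq_add_cos_sq a + Real.sin_sq_add_cos_sq b
  have hc : Real.cos (a - b) ≤ 7 / 8 := by
    have h := Real.cos_le_one_sub_mul_cos_sq (x := a - b) (by linarith [Real.pi_gt_three])
    have hpi : Real.pi ^ 2 ≤ 16 := by nlinarith [Real.pi_le_four, Real.pi_pos]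
    have h3 : 1 / 8 ≤ 2 / Real.pi ^ 2 := by
      rw [div_le_div_iff₀ (by norm_num) (by positivity)]; linarith
    have h4 : 1 ≤ (a - b) ^ 2 := by rw [← sq_abs]; nlinarith
    nlinarith
  have hpos : ∀ t : ℝ, 1 / 8 ≤ t ^ 2 → (1 / 8) ^ (p / 2) ≤ |t| ^ p := by
    intro t ht
    have h := Real.rpow_le_rpow (by norm_num) ht (by positivity : 0 ≤ p / 2)
    rw [← sq_abs, ← Real.rpow_natCast, ← Real.rpow_mul (abs_nonneg _)] at h
    refine h.trans (le_of_eq ?_)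
    congr 1; push_cast; ring
  have n1 : 0 ≤ |Real.cos a - Real.cos b| ^ p := by positivity
  have n2 : 0 ≤ |Real.sin a - Real.sin b| ^ p := by positivity
  rcases le_total (1 / 8) ((Real.cos a - Real.cos b) ^ 2) with h | h
  · linarith [hpos _ h]
  · linarith [hpos (Real.sin a - Real.sin b) (by linarith)]

/-- A lacunary trigonometric embedding of the snowflake of the integers. -/
theorem exists_trig_snowflake_bounds {p r : ℝ} (hr : 0 < r) (hrp : r < p) :
    ∃ c C : ℝ, 0 < c ∧ 0 < C ∧ ∀ (L : ℕ) (a b : ℤ), |a - b| < 2 ^ L →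
      c * |((a - b : ℤ) : ℝ)| ^ r ≤ ∑ k ∈ Finset.range L, ((2 : ℝ) ^ k) ^ r *
        (|Real.cos (a / 2 ^ k) - Real.cos (b / 2 ^ k)| ^ p +
          |Real.sin (a / 2 ^ k) - Real.sin (b / 2 ^ k)| ^ p) ∧
      ∑ k ∈ Finset.range L, ((2 : ℝ) ^ k) ^ r *
        (|Real.cos (a / 2 ^ k) - Real.cos (b / 2 ^ k)| ^ p +
          |Real.sin (a / 2 ^ k) - Real.sin (b / 2 ^ k)| ^ p) ≤ C * |((a - b : ℤ) : ℝ)| ^ r := by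
  have hp : 0 < p := hr.trans hrp
  have ha1 : (1 : ℝ) < 2 ^ r := Real.one_lt_rpow (by norm_num) hr
  have hb1 : (2 : ℝ) ^ (-(p - r)) < 1 := Real.rpow_lt_one_of_one_lt_of_neg (by norm_num) (by linarith)
  have hb0 : (0 : ℝ) < 2 ^ (-(p - r)) := by positivity
  have hA : 0 < (2 : ℝ) ^ r - 1 := by linarith
  have hB : 0 < 1 - (2 : ℝ) ^ (-(p - r)) := by linarith
  refine ⟨(1 / 8) ^ (p / 2) / 2 ^ r, 2 * 2 ^ p * (2 ^ r / (2 ^ r - 1)) +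
    2 / (1 - 2 ^ (-(p - r))), by positivity, by positivity, fun L a b hL => ?_⟩
  rcases eq_or_ne a b with rfl | hab
  · simp [Real.zero_rpow hr.ne', Real.zero_rpow hp.ne']
  obtain ⟨t, ht⟩ : ∃ t : ℕ, t = (a - b).natAbs := ⟨_, rfl⟩
  have htZ : |a - b| = (t : ℤ) := by rw [ht]; exact Int.abs_eq_natAbs _
  have htR : |((a - b : ℤ) : ℝ)| = t := by
    rw [← Int.cast_abs, htZ, Int.cast_natCast]
  have ht0 : t ≠ 0 := by rw [ht]; simpa [sub_eq_zero] using hab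
  have htpos : (0 : ℝ) < t := by exact_mod_cast Nat.pos_of_ne_zero ht0
  have hdiff : ∀ k : ℕ, |(a : ℝ) / 2 ^ k - b / 2 ^ k| = t / 2 ^ k := by
    intro k
    rw [← sub_div, abs_div, abs_of_pos (by positivity : (0 : ℝ) < 2 ^ k), ← htR]
    push_cast; rfl
  rw [htZ] at hL
  have hL' : t < 2 ^ L := by exact_mod_cast hL
  rw [htR]
  set k₀ := Nat.log 2 t with hk₀
  have hk1 : 2 ^ k₀ ≤ t := Nat.pow_log_le_self 2 ht0
  have hk2 : t < 2 ^ (k₀ + 1) := Nat.lt_pow_succ_log_self (by norm_num) t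
  have hk1' : (2 : ℝ) ^ k₀ ≤ t := by exact_mod_cast hk1
  have hk2' : (t : ℝ) < 2 ^ (k₀ + 1) := by exact_mod_cast hk2
  have hkL : k₀ < L := (Nat.pow_lt_pow_iff_right (by norm_num)).1 (hk1.trans_lt hL')
  constructor
  · have hterm : (1 / 8) ^ (p / 2) / 2 ^ r * (t : ℝ) ^ r ≤ ((2 : ℝ) ^ k₀) ^ r *
        (|Real.cos (a / 2 ^ k₀) - Real.cos (b / 2 ^ k₀)| ^ p +
          |Real.sin (a / 2 ^ k₀) - Real.sin (b / 2 ^ k₀)| ^ p) := by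
      have h1 := le_abs_cos_sub_cos_rpow_add hp (a := a / 2 ^ k₀) (b := b / 2 ^ k₀)
        (by rw [hdiff, le_div_iff₀ (by positivity)]; linarith)
        (by rw [hdiff, div_le_iff₀ (by positivity)]; rw [pow_succ] at hk2'; linarith)
      have h2 : (t : ℝ) ^ r ≤ 2 ^ r * ((2 : ℝ) ^ k₀) ^ r := by
        rw [← Real.mul_rpow (by norm_num) (by positivity)]
        refine Real.rpow_le_rpow htpos.le ?_ hr.le
        rw [pow_succ] at hk2'; linarith
      calc _ ≤ (1 / 8) ^ (p / 2) / 2 ^ r * (2 ^ r * ((2 : ℝ) ^ k₀) ^ r) := by gcongr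
        _ = ((2 : ℝ) ^ k₀) ^ r * (1 / 8) ^ (p / 2) := by field_simp
        _ ≤ _ := by gcongr
    exact hterm.trans (Finset.single_le_sum (f := fun k => ((2 : ℝ) ^ k) ^ r *
        (|Real.cos (a / 2 ^ k) - Real.cos (b / 2 ^ k)| ^ p +
          |Real.sin (a / 2 ^ k) - Real.sin (b / 2 ^ k)| ^ p)) (fun k _ => by positivity)
        (Finset.mem_range.2 hkL))
  · rw [Finset.range_eq_Ico, ← Finset.sum_Ico_consecutive _ (Nat.zero_le (k₀ + 1)) hkL, add_mul,
      ← Finset.range_eq_Ico]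
    have hpr : ∀ (s : ℝ) (k : ℕ), ((2 : ℝ) ^ k) ^ s = (2 ^ s) ^ k := fun s k => by
      rw [← Real.rpow_natCast, ← Real.rpow_natCast, ← Real.rpow_mul (by norm_num),
        ← Real.rpow_mul (by norm_num), mul_comm]
    refine add_le_add ?_ ?_
    · calc _ ≤ ∑ k ∈ Finset.range (k₀ + 1), 2 * 2 ^ p * ((2 : ℝ) ^ r) ^ k := by
            refine Finset.sum_le_sum fun k _ => ?_
            rw [← hpr, mul_comm]
            gcongr
            refine (abs_cos_sub_cos_rpow_add_le hp _ _).trans ?_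
            gcongr
            exact min_le_right _ _
        _ = 2 * 2 ^ p * (((2 ^ r) ^ (k₀ + 1) - 1) / (2 ^ r - 1)) := by
            rw [← Finset.mul_sum, geom_sum_eq ha1.ne']
        _ ≤ 2 * 2 ^ p * ((2 ^ r * (t : ℝ) ^ r) / (2 ^ r - 1)) := by
            gcongr
            have : ((2 : ℝ) ^ r) ^ (k₀ + 1) ≤ 2 ^ r * (t : ℝ) ^ r := by
              rw [pow_succ, mul_comm, ← hpr]
              gcongr
            linarith
        _ = _ := by ring
    · calc _ ≤ ∑ k ∈ Finset.Ico (k₀ + 1) L, 2 * (t : ℝ) ^ p * ((2 : ℝ) ^ (-(p - r))) ^ k := by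
            refine Finset.sum_le_sum fun k _ => ?_
            have h1 := abs_cos_sub_cos_rpow_add_le hp (a / 2 ^ k) (b / 2 ^ k)
            rw [hdiff] at h1
            have h2 : min ((t : ℝ) / 2 ^ k) 2 ^ p ≤ (t / 2 ^ k) ^ p :=
              Real.rpow_le_rpow (by positivity) (min_le_left _ _) hp.le
            rw [Real.div_rpow htpos.le (by positivity)] at h2
            calc _ ≤ ((2 : ℝ) ^ k) ^ r * (2 * ((t : ℝ) ^ p / (2 ^ k) ^ p)) := by
                  gcongr
                  linarith
              _ = _ := by
                  rw [← hpr, neg_sub, Real.rpow_sub (by positivity)]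
                  ring
        _ ≤ 2 * (t : ℝ) ^ p * ((2 ^ (-(p - r))) ^ (k₀ + 1) / (1 - 2 ^ (-(p - r)))) := by
            rw [← Finset.mul_sum]
            gcongr
            exact geom_sum_Ico_le_of_lt_one hb0.le hb1
        _ ≤ 2 * (t : ℝ) ^ p * ((t : ℝ) ^ (-(p - r)) / (1 - 2 ^ (-(p - r)))) := by
            gcongr
            rw [← hpr]
            exact Real.rpow_le_rpow_of_nonpos htpos hk2'.le (by linarith)
        _ = 2 / (1 - 2 ^ (-(p - r))) * (t : ℝ) ^ r := by
            have : (t : ℝ) ^ r = (t : ℝ) ^ p * (t : ℝ) ^ (-(p - r)) := by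
              rw [← Real.rpow_add htpos]; congr 1; ring
            rw [this]; ring

theorem gridDist_nonneg {n M : ℕ} (q : ℝ) (x y : Fin n → Fin M) : 0 ≤ gridDist q x y :=
  lqDist_nonneg q _ _

/-- The embedding of the grid into `ℓ_p` through a snowflake of the Euclidean metric. -/
theorem exists_embedding_grid {p q : ℝ} (hq : 2 < q) (hqp : q < p) :
    ∃ C : ℝ, 0 < C ∧ ∀ n M : ℕ, 0 < M → ∃ f : (Fin n → Fin M) → LpSpace p, ∀ x y,
      gridDist q x y ≤ ‖f x - f y‖ ∧
        ‖f x - f y‖ ≤ C * (M : ℝ) ^ (1 - 2 / q) * gridDist q x y := by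
  have hq0 : 0 < q := by linarith
  have hp0 : 0 < p := by linarith
  have hr2 : 2 ≤ 2 * p / q := by rw [le_div_iff₀ hq0]; linarith
  have hrp : 2 * p / q < p := by rw [div_lt_iff₀ hq0]; nlinarith
  have hr2' : 2 * p / q / 2 = p / q := by ring
  set r := 2 * p / q with hr
  have hr0 : 0 < r := by linarith
  obtain ⟨c₁, C₁, hc₁, hC₁, htrig⟩ := exists_trig_snowflake_bounds hr0 hrp
  set K : ℝ := r ^ r * (2 * Real.exp (1 / 2)) with hK
  have hK0 : 0 < K := by positivity
  refine ⟨(C₁ * K) ^ (1 / p) / c₁ ^ (1 / p), by positivity, fun n M hM => ?_⟩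
  have hM0 : (0 : ℝ) < M := by exact_mod_cast hM
  set N : ℝ := (Fintype.card (Fin n → ℤˣ) : ℝ) with hN
  have hN0 : 0 < N := by rw [hN]; exact_mod_cast Fintype.card_pos
  let ip : (Fin n → Fin M) → (Fin n → ℤˣ) → ℤ := fun x ε => ∑ i, ((x i : ℕ) : ℤ) * (ε i : ℤ)
  let trig : Bool → ℝ → ℝ := fun b => if b then Real.cos else Real.sin
  let g : (Fin n → Fin M) → (Fin n → ℤˣ) × Fin (n * M) × Bool → ℝ := fun x i =>
    (N⁻¹ * ((2 : ℝ) ^ (i.2.1 : ℕ)) ^ r) ^ (1 / p) * trig i.2.2 (ip x i.1 / 2 ^ (i.2.1 : ℕ))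
  have hg : ∀ x y, ∑ i, |g x i - g y i| ^ p = N⁻¹ * ∑ ε : Fin n → ℤˣ,
      ∑ k ∈ Finset.range (n * M), ((2 : ℝ) ^ k) ^ r *
        (|Real.cos (ip x ε / 2 ^ k) - Real.cos (ip y ε / 2 ^ k)| ^ p +
          |Real.sin (ip x ε / 2 ^ k) - Real.sin (ip y ε / 2 ^ k)| ^ p) := by
    intro x y
    simp only [g]
    rw [Fintype.sum_prod_type, Finset.mul_sum]
    refine Finset.sum_congr rfl fun ε _ => ?_
    rw [Fintype.sum_prod_type, Finset.sum_range, Finset.mul_sum]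
    refine Finset.sum_congr rfl fun k _ => ?_
    have hw : ∀ s : ℝ, |(N⁻¹ * ((2 : ℝ) ^ (k : ℕ)) ^ r) ^ (1 / p) * s| ^ p =
        N⁻¹ * ((2 : ℝ) ^ (k : ℕ)) ^ r * |s| ^ p := by
      intro s
      rw [abs_mul, abs_of_nonneg (by positivity), Real.mul_rpow (by positivity) (abs_nonneg _),
        ← Real.rpow_mul (by positivity), one_div_mul_cancel hp0.ne', Real.rpow_one]
    simp only [← mul_sub, hw, Fintype.sum_bool, trig, if_true, Bool.false_eq_true, if_false]
    ring
  have hip : ∀ x y ε, ((ip x ε - ip y ε : ℤ) : ℝ) =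
      ∑ i, (((x i : ℕ) : ℝ) - ((y i : ℕ) : ℝ)) * ((ε i : ℤ) : ℝ) := by
    intro x y ε
    simp only [ip]
    rw [← Finset.sum_sub_distrib]
    push_cast
    exact Finset.sum_congr rfl fun i _ => by ring
  have hsmall : ∀ x y ε, |ip x ε - ip y ε| < 2 ^ (n * M) := by
    intro x y ε
    have h1 : |ip x ε - ip y ε| ≤ ∑ _i : Fin n, (M : ℤ) := by
      simp only [ip]
      rw [← Finset.sum_sub_distrib]
      refine (Finset.abs_sum_le_sum_abs _ _).trans (Finset.sum_le_sum fun i _ => ?_)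
      rw [← sub_mul, abs_mul, Int.isUnit_iff_abs_eq.1 (ε i).isUnit, mul_one, abs_le]
      have := (x i).2
      have := (y i).2
      omega
    have h2 : n * M < 2 ^ (n * M) := Nat.lt_two_pow_self
    have h3 : ((n * M : ℕ) : ℤ) < 2 ^ (n * M) := by exact_mod_cast h2
    simp only [Finset.sum_const, Finset.card_univ, Fintype.card_fin, nsmul_eq_mul] at h1
    push_cast at h3
    exact h1.trans_lt h3
  have hZ : ∀ x y : Fin n → Fin M,
      ∑ i, (((x i : ℕ) : ℝ) - ((y i : ℕ) : ℝ)) ^ 2 ≤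
        ∑ i, |((x i : ℕ) : ℝ) - ((y i : ℕ) : ℝ)| ^ q ∧
      ∑ i, |((x i : ℕ) : ℝ) - ((y i : ℕ) : ℝ)| ^ q ≤
        (M : ℝ) ^ (q - 2) * ∑ i, (((x i : ℕ) : ℝ) - ((y i : ℕ) : ℝ)) ^ 2 := by
    intro x y
    rw [Finset.mul_sum]
    have key : ∀ i, (((x i : ℕ) : ℝ) - ((y i : ℕ) : ℝ)) ^ 2 ≤
        |((x i : ℕ) : ℝ) - ((y i : ℕ) : ℝ)| ^ q ∧ |((x i : ℕ) : ℝ) - ((y i : ℕ) : ℝ)| ^ q ≤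
        (M : ℝ) ^ (q - 2) * (((x i : ℕ) : ℝ) - ((y i : ℕ) : ℝ)) ^ 2 := by
      intro i
      have hi : |((x i : ℕ) : ℤ) - ((y i : ℕ) : ℤ)| ≤ M := by
        have := (x i).2
        have := (y i).2
        rw [abs_le]; omega
      have hiR : |((x i : ℕ) : ℝ) - ((y i : ℕ) : ℝ)| ≤ M := by exact_mod_cast hi
      have hcase : ((x i : ℕ) : ℝ) - ((y i : ℕ) : ℝ) = 0 ∨
          1 ≤ |((x i : ℕ) : ℝ) - ((y i : ℕ) : ℝ)| := by
        rcases eq_or_ne (((x i : ℕ) : ℤ) - ((y i : ℕ) : ℤ)) 0 with h | h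
        · left; exact_mod_cast h
        · right; exact_mod_cast Int.one_le_abs h
      generalize ((x i : ℕ) : ℝ) - ((y i : ℕ) : ℝ) = z at *
      rcases hcase with rfl | h1
      · simp [Real.zero_rpow hq0.ne']
      · have e : |z| ^ q = |z| ^ (q - 2) * z ^ 2 := by
          rw [← sq_abs, ← Real.rpow_natCast, ← Real.rpow_add (by linarith)]
          congr 1; push_cast; ring
        have h2 : 1 ≤ |z| ^ (q - 2) := Real.one_le_rpow h1 (by linarith)
        have h3 : |z| ^ (q - 2) ≤ (M : ℝ) ^ (q - 2) :=
          Real.rpow_le_rpow (abs_nonneg _) hiR (by linarith)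
        rw [e]
        constructor <;> nlinarith [sq_nonneg z]
    exact ⟨Finset.sum_le_sum fun i _ => (key i).1, Finset.sum_le_sum fun i _ => (key i).2⟩
  obtain ⟨f, hf⟩ := exists_embedding_of_finite (p := p) (by linarith) (d := gridDist q)
    (gridDist_nonneg q) g (A := c₁ ^ (1 / p) * (M : ℝ) ^ (-(1 - 2 / q))) (B := (C₁ * K) ^ (1 / p))
    (by positivity) (by positivity)
    (fun x y => by
      have e : (M : ℝ) ^ (-(1 - 2 / q) * p) * ((M : ℝ) ^ (q - 2)) ^ (p / q) = 1 := by
        rw [← Real.rpow_mul hM0.le, ← Real.rpow_add hM0]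
        have : -(1 - 2 / q) * p + (q - 2) * (p / q) = 0 := by field_simp; ring
        rw [this, Real.rpow_zero]
      have hS := Real.rpow_le_rpow (Finset.sum_nonneg fun _ _ => by positivity) (hZ x y).2
        (by positivity : 0 ≤ p / q)
      have hS0 : 0 ≤ ∑ i, (((x i : ℕ) : ℝ) - ((y i : ℕ) : ℝ)) ^ 2 :=
        Finset.sum_nonneg fun _ _ => sq_nonneg _
      rw [Real.mul_rpow (by positivity) hS0] at hS
      rw [Real.mul_rpow (by positivity) (gridDist_nonneg q x y), Real.mul_rpow (by positivity)
        (by positivity), ← Real.rpow_mul hc₁.le, one_div_mul_cancel hp0.ne', Real.rpow_one,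
        ← Real.rpow_mul hM0.le, gridDist, lqDist_rpow, hg]
      calc _ ≤ c₁ * (M : ℝ) ^ (-(1 - 2 / q) * p) * (((M : ℝ) ^ (q - 2)) ^ (p / q) *
            (∑ i, (((x i : ℕ) : ℝ) - ((y i : ℕ) : ℝ)) ^ 2) ^ (p / q)) := by gcongr
        _ = c₁ * (∑ i, (((x i : ℕ) : ℝ) - ((y i : ℕ) : ℝ)) ^ 2) ^ (r / 2) := by
            rw [mul_assoc, ← mul_assoc ((M : ℝ) ^ (-(1 - 2 / q) * p)), e, one_mul, hr2']
        _ ≤ c₁ * (N⁻¹ * ∑ ε : Fin n → ℤˣ, |((ip x ε - ip y ε : ℤ) : ℝ)| ^ r) := by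
            simp only [hip]
            gcongr
            exact le_avg_abs_sign_linear_rpow hr2 (fun i => ((x i : ℕ) : ℝ) - ((y i : ℕ) : ℝ))
        _ = N⁻¹ * ∑ ε : Fin n → ℤˣ, c₁ * |((ip x ε - ip y ε : ℤ) : ℝ)| ^ r := by
            rw [← Finset.mul_sum]; ring
        _ ≤ _ := by
            refine mul_le_mul_of_nonneg_left (Finset.sum_le_sum fun ε _ => ?_) (by positivity)
            exact (htrig _ _ _ (hsmall x y ε)).1)
    (fun x y => by
      have hS := Real.rpow_le_rpow (Finset.sum_nonneg fun _ _ => sq_nonneg _) (hZ x y).1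
        (by positivity : 0 ≤ p / q)
      rw [Real.mul_rpow (by positivity) (gridDist_nonneg q x y), ← Real.rpow_mul (by positivity),
        one_div_mul_cancel hp0.ne', Real.rpow_one, gridDist, lqDist_rpow, hg]
      calc _ ≤ N⁻¹ * ∑ ε : Fin n → ℤˣ, C₁ * |((ip x ε - ip y ε : ℤ) : ℝ)| ^ r := by
            refine mul_le_mul_of_nonneg_left (Finset.sum_le_sum fun ε _ => ?_) (by positivity)
            exact (htrig _ _ _ (hsmall x y ε)).2
        _ = C₁ * (N⁻¹ * ∑ ε : Fin n → ℤˣ, |((ip x ε - ip y ε : ℤ) : ℝ)| ^ r) := by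
            rw [← Finset.mul_sum]; ring
        _ ≤ C₁ * (K * (∑ i, (((x i : ℕ) : ℝ) - ((y i : ℕ) : ℝ)) ^ 2) ^ (r / 2)) := by
            simp only [hip]
            exact mul_le_mul_of_nonneg_left (avg_abs_sign_linear_rpow_le hr0
              (fun i => ((x i : ℕ) : ℝ) - ((y i : ℕ) : ℝ))) hC₁.le
        _ ≤ C₁ * K * (∑ i, |((x i : ℕ) : ℝ) - ((y i : ℕ) : ℝ)| ^ q) ^ (p / q) := by
            rw [hr2', ← mul_assoc]
            gcongr)
  refine ⟨f, fun x y => ?_⟩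
  have h := hf x y
  have e : (C₁ * K) ^ (1 / p) / (c₁ ^ (1 / p) * (M : ℝ) ^ (-(1 - 2 / q))) =
      (C₁ * K) ^ (1 / p) / c₁ ^ (1 / p) * (M : ℝ) ^ (1 - 2 / q) := by
    rw [Real.rpow_neg hM0.le]
    field_simp
  rwa [e] at h

theorem one_le_LpDistortion {p : ℝ} {X : Type*} {d : X → X → ℝ} {B : ℝ} (hB : 1 ≤ B)
    (h : ∃ f : X → LpSpace p, ∀ x y, d x y ≤ ‖f x - f y‖ ∧ ‖f x - f y‖ ≤ B * d x y) :
    1 ≤ LpDistortion p d :=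
  le_csInf ⟨B, hB, h⟩ fun _ hD => hD.1

theorem LpDistortion_le {p : ℝ} {X : Type*} {d : X → X → ℝ} {B : ℝ} (hB : 1 ≤ B)
    (h : ∃ f : X → LpSpace p, ∀ x y, d x y ≤ ‖f x - f y‖ ∧ ‖f x - f y‖ ≤ B * d x y) :
    LpDistortion p d ≤ B :=
  csInf_le ⟨1, fun _ hD => hD.1⟩ ⟨hB, h⟩

theorem LpDistortion_comp_le {p : ℝ} {X Y : Type*} {d : X → X → ℝ} {B : ℝ} (hB : 1 ≤ B)
    (h : ∃ f : X → LpSpace p, ∀ x y, d x y ≤ ‖f x - f y‖ ∧ ‖f x - f y‖ ≤ B * d x y)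
    (g : Y → X) : LpDistortion p (fun x y => d (g x) (g y)) ≤ LpDistortion p d :=
  csInf_le_csInf ⟨1, fun _ hD => hD.1⟩ ⟨B, hB, h⟩ fun _ hD =>
    ⟨hD.1, hD.2.choose ∘ g, fun x y => hD.2.choose_spec (g x) (g y)⟩

/-- The `L_p` distortion of `ℓ_q^n` and of its grids: two-sided estimates in terms of the
critical size `n ^ ((p - q) / (q * (p - 2)))`. -/
theorem exists_distortion_estimates {p q : ℝ} (hq : 2 < q) (hqp : q < p) :
    ∃ C : ℝ, 0 < C ∧ ∀ n : ℕ, 0 < n →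
      LpDistortion p (fun x y : Fin n → ℝ => lqDist q x y) ≤
        C * ((n : ℝ) ^ ((p - q) / (q * (p - 2)))) ^ (1 - 2 / q) ∧
      ∀ M : ℕ, 0 < M →
        1 ≤ LpDistortion p (fun x y : Fin n → Fin M => gridDist q x y) ∧
        LpDistortion p (fun x y : Fin n → Fin M => gridDist q x y) ≤
          LpDistortion p (fun x y : Fin n → ℝ => lqDist q x y) ∧
        LpDistortion p (fun x y : Fin n → Fin M => gridDist q x y) ≤
          C * (M : ℝ) ^ (1 - 2 / q) := by
  have hq0 : 0 < q := by linarith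
  have hp2 : 0 < p - 2 := by linarith
  have hδ : 0 ≤ 1 - 2 / q := by rw [sub_nonneg, div_le_one hq0]; exact hq.le
  obtain ⟨C₁, hC₁, h₁⟩ := exists_embedding_lq (p := p) (γ := (q - 2) * (p - q) / (q ^ 2 * (p - 2)))
    hq hqp rfl
  obtain ⟨C₂, hC₂, h₂⟩ := exists_embedding_grid hq hqp
  have hone : ∀ {a C : ℝ}, 1 ≤ a → 0 < C → 1 ≤ (C + 1) * a := fun ha hC => by nlinarith
  refine ⟨C₁ + C₂ + 1, by positivity, fun n hn => ?_⟩
  have hn1 : (1 : ℝ) ≤ n := by exact_mod_cast hn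
  have e : ((n : ℝ) ^ ((p - q) / (q * (p - 2)))) ^ (1 - 2 / q) =
      (n : ℝ) ^ ((q - 2) * (p - q) / (q ^ 2 * (p - 2))) := by
    rw [← Real.rpow_mul (by positivity)]
    congr 1
    field_simp
  have hnγ : 1 ≤ (n : ℝ) ^ ((q - 2) * (p - q) / (q ^ 2 * (p - 2))) :=
    Real.one_le_rpow hn1 (div_nonneg (mul_nonneg (by linarith) (by linarith)) (by positivity))
  rw [e]
  have hB₁ : 1 ≤ (C₁ + C₂ + 1) * (n : ℝ) ^ ((q - 2) * (p - q) / (q ^ 2 * (p - 2))) :=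
    hone hnγ (by positivity)
  have hf₁ : ∃ f : (Fin n → ℝ) → LpSpace p, ∀ x y, lqDist q x y ≤ ‖f x - f y‖ ∧
      ‖f x - f y‖ ≤ (C₁ + C₂ + 1) * (n : ℝ) ^ ((q - 2) * (p - q) / (q ^ 2 * (p - 2))) *
        lqDist q x y := by
    obtain ⟨f, hf⟩ := h₁ n hn
    refine ⟨f, fun x y => ⟨(hf x y).1, (hf x y).2.trans ?_⟩⟩
    have := lqDist_nonneg q x y
    gcongr
    linarith
  refine ⟨LpDistortion_le hB₁ hf₁, fun M hM => ?_⟩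
  have hM1 : (1 : ℝ) ≤ M := by exact_mod_cast hM
  have hB₂ : 1 ≤ (C₁ + C₂ + 1) * (M : ℝ) ^ (1 - 2 / q) :=
    hone (Real.one_le_rpow hM1 hδ) (by positivity)
  have hf₂ : ∃ f : (Fin n → Fin M) → LpSpace p, ∀ x y, gridDist q x y ≤ ‖f x - f y‖ ∧
      ‖f x - f y‖ ≤ (C₁ + C₂ + 1) * (M : ℝ) ^ (1 - 2 / q) * gridDist q x y := by
    obtain ⟨f, hf⟩ := h₂ n M hM
    refine ⟨f, fun x y => ⟨(hf x y).1, (hf x y).2.trans ?_⟩⟩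
    have := gridDist_nonneg q x y
    gcongr
    linarith
  exact ⟨one_le_LpDistortion hB₂ hf₂, LpDistortion_comp_le hB₁ hf₁
    (fun (x : Fin n → Fin M) i => ((x i : ℕ) : ℝ)), LpDistortion_le hB₂ hf₂⟩

theorem exists_le_LpDistortion_grid {p q c₀ : ℝ} (hq : 2 < q) (hqp : q < p) (hc₀ : 0 < c₀) :
    ∃ c : ℝ, 0 < c ∧ ∀ n M : ℕ, 0 < n → 2 ≤ M →
      2 ≤ (n : ℝ) ^ ((p - q) / (q * (p - 2))) →
      c₀ * (n : ℝ) ^ ((p - q) / (q * (p - 2))) ≤ M →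
      c * ((n : ℝ) ^ ((p - q) / (q * (p - 2)))) ^ (1 - 2 / q) ≤
        LpDistortion p (fun x y : Fin n → Fin M => gridDist q x y) := by
  have hq0 : 0 < q := by linarith
  have hp2 : 0 < p - 2 := by linarith
  obtain ⟨C, hC, hemb⟩ := exists_embedding_grid hq hqp
  obtain ⟨c, hc, h⟩ := exists_le_distortion_of_grid_embedding (p := p) (q := q)
    (α := (p - q) / (q * (p - 2))) (β := p * (q - 2) / (q * (p - 2)))
    (γ := (q - 2) * (p - q) / (q ^ 2 * (p - 2))) (by linarith) hq0
    (div_nonneg (mul_nonneg (by linarith) (by linarith)) (by positivity))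
    (by field_simp; ring) (by field_simp; ring) (by field_simp; ring) hc₀
  refine ⟨c, hc, fun n M hn hM h2 hMn => ?_⟩
  have e : ((n : ℝ) ^ ((p - q) / (q * (p - 2)))) ^ (1 - 2 / q) =
      (n : ℝ) ^ ((q - 2) * (p - q) / (q ^ 2 * (p - 2))) := by
    rw [← Real.rpow_mul (by positivity)]
    congr 1
    field_simp
  rw [e]
  obtain ⟨f, hf⟩ := hemb n M (by omega)
  refine le_csInf ⟨max 1 (C * (M : ℝ) ^ (1 - 2 / q)), le_max_left _ _, f, fun x y =>
    ⟨(hf x y).1, (hf x y).2.trans (mul_le_mul_of_nonneg_right (le_max_right _ _)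
      (gridDist_nonneg q x y))⟩⟩ ?_
  rintro D ⟨hD, g, hg⟩
  refine h n M D g hn hM ?_ hMn (by linarith) hg
  rw [mul_comm, Real.rpow_mul (by positivity)]
  norm_cast
  nlinarith

/-- **Corollary 1.2: sharp phase transition of the `L_p` distortion of `ℓ_q^n` grids.**
Let `2 < q < p < ∞`. (i) For every `c₀ > 0` there are `c, C > 0` depending only on
`p, q, c₀` such that whenever `m ≥ c₀ n^{(p-q)/(q(p-2))}` one has
`c c_p(ℓ_q^n) ≤ c_p([m]_q^n) ≤ C c_p(ℓ_q^n)`. (ii) If `m_n/n^{(p-q)/(q(p-2))} → 0`, then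
`c_p([m_n]_q^n)/c_p(ℓ_q^n) → 0`. -/
theorem grid_distortion_phase_transition (p q : ℝ) (hp : 2 < p) (hq : 2 < q) (hqp : q < p) :
    (∀ c₀ : ℝ, 0 < c₀ → ∃ c C : ℝ, 0 < c ∧ 0 < C ∧ ∀ m n : ℕ, 0 < m → 0 < n →
      c₀ * (n : ℝ) ^ ((p - q) / (q * (p - 2))) ≤ (m : ℝ) →
      c * LpDistortion p (fun x y : Fin n → ℝ => lqDist q x y) ≤
          LpDistortion p (fun x y : Fin n → Fin m => gridDist q x y) ∧
        LpDistortion p (fun x y : Fin n → Fin m => gridDist q x y) ≤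
          C * LpDistortion p (fun x y : Fin n → ℝ => lqDist q x y)) ∧
    (∀ mseq : ℕ → ℕ, (∀ n, 0 < mseq n) →
      Filter.Tendsto (fun n : ℕ => (mseq n : ℝ) / (n : ℝ) ^ ((p - q) / (q * (p - 2))))
        Filter.atTop (nhds 0) →
      Filter.Tendsto (fun n : ℕ =>
          LpDistortion p (fun x y : Fin n → Fin (mseq n) => gridDist q x y) /
            LpDistortion p (fun x y : Fin n → ℝ => lqDist q x y))
        Filter.atTop (nhds 0)) := by
  have hq0 : 0 < q := by linarith
  have hp2 : 0 < p - 2 := by linarith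
  have hα : 0 < (p - q) / (q * (p - 2)) := div_pos (by linarith) (by positivity)
  have hδ : 0 < 1 - 2 / q := by rw [sub_pos, div_lt_one hq0]; exact hq
  obtain ⟨C, hC, hup⟩ := exists_distortion_estimates hq hqp
  set α := (p - q) / (q * (p - 2)) with hα'
  set δ := 1 - 2 / q with hδ'
  constructor
  · intro c₀ hc₀
    obtain ⟨c, hc, hlow⟩ := exists_le_LpDistortion_grid hq hqp hc₀
    set T := max 2 (2 / c₀) with hT
    have hT0 : 0 < T := lt_of_lt_of_le two_pos (le_max_left _ _)
    refine ⟨min (c / C) (1 / (C * T ^ δ)), 1, lt_min (by positivity) (by positivity), one_pos,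
      fun m n hm hn hmn => ?_⟩
    obtain ⟨hub, hgrid⟩ := hup n hn
    obtain ⟨h1, hle, -⟩ := hgrid m hm
    refine ⟨?_, by rwa [one_mul]⟩
    have hl0 : 0 ≤ LpDistortion p (fun x y : Fin n → ℝ => lqDist q x y) := by linarith
    rcases le_or_gt T ((n : ℝ) ^ α) with hTn | hTn
    · have h2 : 2 ≤ (n : ℝ) ^ α := (le_max_left _ _).trans hTn
      have h3 : 2 / c₀ ≤ (n : ℝ) ^ α := (le_max_right _ _).trans hTn
      rw [div_le_iff₀' hc₀] at h3
      have hm2 : 2 ≤ m := by exact_mod_cast h3.trans hmn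
      calc _ ≤ c / C * LpDistortion p (fun x y : Fin n → ℝ => lqDist q x y) := by
            gcongr
            exact min_le_left _ _
        _ ≤ c / C * (C * ((n : ℝ) ^ α) ^ δ) := by gcongr
        _ = c * ((n : ℝ) ^ α) ^ δ := by field_simp
        _ ≤ _ := hlow n m hn hm2 h2 hmn
    · calc _ ≤ 1 / (C * T ^ δ) * LpDistortion p (fun x y : Fin n → ℝ => lqDist q x y) := by
            gcongr
            exact min_le_right _ _
        _ ≤ 1 / (C * T ^ δ) * (C * T ^ δ) := by
            gcongr
            exact hub.trans (by gcongr)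
        _ = 1 := one_div_mul_cancel (by positivity)
        _ ≤ _ := h1
  · intro M hM hlim
    obtain ⟨c, hc, hlow⟩ := exists_le_LpDistortion_grid hq hqp one_pos
    have hbound : Filter.Tendsto (fun n : ℕ => C / c * ((M n : ℝ) / (n : ℝ) ^ α) ^ δ)
        Filter.atTop (nhds 0) := by
      have := (hlim.rpow_const (p := δ) (Or.inr hδ.le)).const_mul (C / c)
      rwa [Real.zero_rpow hδ.ne', mul_zero] at this
    have hlarge : ∀ᶠ n : ℕ in Filter.atTop, 2 ≤ (n : ℝ) ^ α :=
      ((tendsto_rpow_atTop hα).comp tendsto_natCast_atTop_atTop).eventually_ge_atTop 2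
    refine squeeze_zero' ?_ ?_ hbound
    · filter_upwards [Filter.eventually_gt_atTop 0] with n hn
      obtain ⟨h1, hle, -⟩ := (hup n hn).2 (M n) (hM n)
      exact div_nonneg (by linarith) (by linarith)
    · filter_upwards [Filter.eventually_gt_atTop 0, hlarge] with n hn h2
      have hceil : (n : ℝ) ^ α ≤ (⌈(n : ℝ) ^ α⌉₊ : ℕ) := Nat.le_ceil _
      have hceil2 : 2 ≤ ⌈(n : ℝ) ^ α⌉₊ := by exact_mod_cast h2.trans hceil
      have hl : c * ((n : ℝ) ^ α) ^ δ ≤ LpDistortion p (fun x y : Fin n → ℝ => lqDist q x y) :=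
        (hlow n _ hn hceil2 h2 (by rwa [one_mul])).trans
          ((hup n hn).2 _ (by omega)).2.1
      obtain ⟨h1, -, hle⟩ := (hup n hn).2 (M n) (hM n)
      have hn0 : 0 < (n : ℝ) ^ α := by linarith
      calc _ ≤ C * (M n : ℝ) ^ δ / (c * ((n : ℝ) ^ α) ^ δ) := by gcongr
        _ = _ := by
            rw [Real.div_rpow (by positivity) hn0.le]
            field_simp
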